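/- arXiv:2004.12931 — 4 statements merged into one kernel-verified Lean document; each statement's English description precedes it below -/
import Mathlib

section
/- Suppose α° ∈ ℝ^d is a critical point of λ, λ(α°) is a simple eigenvalue of T(α°), and its unit eigenvector f° is non-vanishing on crossing edges. If the Hermitian d×d matrix W is positive semidefinite, then λ(α°) ≤ λ(α) for all α ∈ ℝ^d, i.e. λ attains its global minimum at α°. -/
noncomputable section

open Matrix Complex
open scoped ComplexOrder

/-- Eigenvalues of a square complex matrix, sorted in increasing order
(junk value `0` if the matrix is not Hermitian). -/
noncomputable def sortedEigs {n : ℕ} (A : Matrix (Fin n) (Fin n) ℂ) : Fin n → ℝ :=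
  if hA : A.IsHermitian then hA.eigenvalues ∘ Tuple.sort hA.eigenvalues else 0

/-- The Moore–Penrose pseudoinverse of a Hermitian matrix (junk value `0` otherwise). -/
noncomputable def pinvH {m : Type*} [Fintype m] [DecidableEq m] (A : Matrix m m ℂ) :
    Matrix m m ℂ :=
  if hA : A.IsHermitian then
    (hA.eigenvectorUnitary : Matrix m m ℂ) *
      Matrix.diagonal (fun i => if hA.eigenvalues i = 0 then 0 else ((hA.eigenvalues i : ℂ))⁻¹) *
      star (hA.eigenvectorUnitary : Matrix m m ℂ)
  else 0

/-- The orthogonal projection onto the null space of a Hermitian matrix. -/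
noncomputable def nullProj {m : Type*} [Fintype m] [DecidableEq m] (A : Matrix m m ℂ) :
    Matrix m m ℂ :=
  1 - pinvH A * A

/-- The number of positive eigenvalues (with multiplicity) of a Hermitian matrix. -/
noncomputable def iPos {m : Type*} [Fintype m] [DecidableEq m] (A : Matrix m m ℂ) : ℕ :=
  if hA : A.IsHermitian then Nat.card {i // 0 < hA.eigenvalues i} else 0

/-- The number of negative eigenvalues (with multiplicity) of a Hermitian matrix. -/
noncomputable def iNeg {m : Type*} [Fintype m] [DecidableEq m] (A : Matrix m m ℂ) : ℕ :=
  if hA : A.IsHermitian then Nat.card {i // hA.eigenvalues i < 0} else 0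

/-- The number of zero eigenvalues (with multiplicity) of a Hermitian matrix. -/
noncomputable def iZero {m : Type*} [Fintype m] [DecidableEq m] (A : Matrix m m ℂ) : ℕ :=
  if hA : A.IsHermitian then Nat.card {i // hA.eigenvalues i = 0} else 0

theorem sortedEigs_monotone {n : ℕ} (A : Matrix (Fin n) (Fin n) ℂ) : Monotone (sortedEigs A) := by
  unfold sortedEigs
  split_ifs with hA
  · exact Tuple.monotone_sort hA.eigenvalues
  · exact monotone_const

/-- Unitary diagonalization of a Hermitian matrix with its eigenvalues in increasing order. -/
theorem Matrix.IsHermitian.exists_unitary_sortedEigs {n : ℕ} {A : Matrix (Fin n) (Fin n) ℂ}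
    (hA : A.IsHermitian) : ∃ U : Matrix (Fin n) (Fin n) ℂ, Uᴴ * U = 1 ∧ U * Uᴴ = 1 ∧
      A = U * Matrix.diagonal (fun i => (sortedEigs A i : ℂ)) * Uᴴ := by
  set σ := Tuple.sort hA.eigenvalues
  have hs : ∀ i, sortedEigs A i = hA.eigenvalues (σ i) := by
    intro i
    simp [sortedEigs, hA, σ]
  have hU := Unitary.coe_star_mul_self hA.eigenvectorUnitary
  have hU' : (hA.eigenvectorUnitary : Matrix (Fin n) (Fin n) ℂ) *
      star (hA.eigenvectorUnitary : Matrix (Fin n) (Fin n) ℂ) = 1 :=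
    Unitary.coe_mul_star_self hA.eigenvectorUnitary
  refine ⟨(hA.eigenvectorUnitary : Matrix (Fin n) (Fin n) ℂ).submatrix id σ, ?_, ?_, ?_⟩
  · rw [conjTranspose_submatrix, ← Equiv.coe_refl, submatrix_mul_equiv,
      ← star_eq_conjTranspose, hU, submatrix_one_equiv]
  · rw [conjTranspose_submatrix, submatrix_mul_equiv, ← star_eq_conjTranspose,
      hU', submatrix_id_id]
  · have hd : Matrix.diagonal (fun i => (sortedEigs A i : ℂ)) =
        (Matrix.diagonal (fun i => (hA.eigenvalues i : ℂ))).submatrix σ σ := by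
      rw [submatrix_diagonal_equiv]
      simp [hs, Function.comp_def]
    rw [hd, conjTranspose_submatrix, submatrix_mul_equiv, submatrix_mul_equiv, submatrix_id_id,
      ← star_eq_conjTranspose]
    conv_lhs => rw [hA.spectral_theorem, Unitary.conjStarAlgAut_apply]
    rfl

/-- The quadratic form of a unitarily diagonalized matrix, shifted by `c`. -/
theorem re_star_dotProduct_sub_smul_mulVec {n : Type*} [Fintype n] [DecidableEq n]
    {A U : Matrix n n ℂ} {a : n → ℝ} (hU : U * Uᴴ = 1)
    (hA : A = U * Matrix.diagonal (fun i => (a i : ℂ)) * Uᴴ) (c : ℝ) (x : n → ℂ) :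
    (star x ⬝ᵥ (A - (c : ℂ) • (1 : Matrix n n ℂ)) *ᵥ x).re =
      ∑ i, (a i - c) * Complex.normSq ((Uᴴ *ᵥ x) i) := by
  have h : A - (c : ℂ) • (1 : Matrix n n ℂ) =
      U * Matrix.diagonal (fun i => ((a i - c : ℝ) : ℂ)) * Uᴴ := by
    have hd : Matrix.diagonal (fun i => ((a i - c : ℝ) : ℂ)) =
        Matrix.diagonal (fun i => (a i : ℂ)) - (c : ℂ) • (1 : Matrix n n ℂ) := by
      ext i j
      by_cases hij : i = j <;> simp [hij]
    rw [hd, mul_sub, sub_mul, ← hA, mul_smul_comm, mul_one, smul_mul_assoc, hU]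
  have hx : star x ᵥ* U = star (Uᴴ *ᵥ x) := by
    rw [star_mulVec, conjTranspose_conjTranspose]
  rw [h, ← mulVec_mulVec, ← mulVec_mulVec, dotProduct_mulVec, hx, dotProduct, Complex.re_sum]
  refine Finset.sum_congr rfl fun i _ => ?_
  rw [mulVec_diagonal]
  simp [Complex.normSq_apply]
  ring

/-- If the form of `C - c` pulled back along a linear map is dominated by the form of `A - c`,
where `c` is the `k`-th eigenvalue of `C`, then the `k`-th eigenvalue of `A` is at least `c`. -/
theorem sortedEigs_le_of_comap_le {n : ℕ} {A C : Matrix (Fin n) (Fin n) ℂ}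
    (hA : A.IsHermitian) (hC : C.IsHermitian) (k : Fin n)
    (L : (Fin n → ℂ) →ₗ[ℂ] (Fin n → ℂ))
    (hL : ∀ x, (star (L x) ⬝ᵥ (C - (sortedEigs C k : ℂ) • (1 : Matrix (Fin n) (Fin n) ℂ)) *ᵥ
        L x).re ≤
      (star x ⬝ᵥ (A - (sortedEigs C k : ℂ) • (1 : Matrix (Fin n) (Fin n) ℂ)) *ᵥ x).re) :
    sortedEigs C k ≤ sortedEigs A k := by
  by_contra! hlt
  obtain ⟨U, -, hU, hAU⟩ := hA.exists_unitary_sortedEigs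
  obtain ⟨V, -, hV, hCV⟩ := hC.exists_unitary_sortedEigs
  let Φ : (Fin n → ℂ) →ₗ[ℂ] (Fin n → ℂ) := LinearMap.pi fun i =>
    if k < i then LinearMap.proj i ∘ₗ Uᴴ.mulVecLin
    else if i < k then LinearMap.proj i ∘ₗ Vᴴ.mulVecLin ∘ₗ L else 0
  have hΦ : ¬ Function.Injective Φ := by
    rw [LinearMap.injective_iff_surjective]
    intro hsurj
    obtain ⟨x, hx⟩ := hsurj (Pi.single k 1)
    have := congrFun hx k
    simp [Φ] at this
  rw [← LinearMap.ker_eq_bot, Submodule.eq_bot_iff] at hΦ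
  push Not at hΦ
  obtain ⟨x, hx, hx0⟩ := hΦ
  have hxA : ∀ i, k < i → (Uᴴ *ᵥ x) i = 0 := by
    intro i hi
    have := congrFun (LinearMap.mem_ker.1 hx) i
    simpa [Φ, hi] using this
  have hxC : ∀ i, i < k → (Vᴴ *ᵥ L x) i = 0 := by
    intro i hi
    have := congrFun (LinearMap.mem_ker.1 hx) i
    simpa [Φ, hi, hi.not_gt] using this
  have hUx : Uᴴ *ᵥ x ≠ 0 := by
    intro h0
    apply hx0
    rw [← one_mulVec x, ← hU, ← mulVec_mulVec, h0, mulVec_zero]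
  obtain ⟨i₀, hi₀⟩ := Function.ne_iff.1 hUx
  have h := hL x
  rw [re_star_dotProduct_sub_smul_mulVec hU hAU, re_star_dotProduct_sub_smul_mulVec hV hCV] at h
  have hneg : ∑ i, (sortedEigs A i - sortedEigs C k) * Complex.normSq ((Uᴴ *ᵥ x) i) < 0 := by
    refine Finset.sum_neg' (fun i _ => ?_) ⟨i₀, Finset.mem_univ _, ?_⟩
    · rcases lt_or_ge k i with hi | hi
      · simp [hxA i hi]
      · have := sortedEigs_monotone A hi
        exact mul_nonpos_of_nonpos_of_nonneg (by linarith) (Complex.normSq_nonneg _)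
    · have hi : i₀ ≤ k := not_lt.1 fun hi => hi₀ (hxA _ hi)
      have := sortedEigs_monotone A hi
      exact mul_neg_of_neg_of_pos (by linarith) (Complex.normSq_pos.2 hi₀)
  have hpos : 0 ≤ ∑ i, (sortedEigs C i - sortedEigs C k) * Complex.normSq ((Vᴴ *ᵥ L x) i) := by
    refine Finset.sum_nonneg fun i _ => ?_
    rcases lt_or_ge i k with hi | hi
    · simp [hxC i hi]
    · have := sortedEigs_monotone C hi
      exact mul_nonneg (by linarith) (Complex.normSq_nonneg _)
  linarith

/-- A simple eigenvalue of a Hermitian matrix has a one-dimensional eigenspace. -/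
theorem Matrix.IsHermitian.exists_eq_smul_of_simple {n : ℕ} {A : Matrix (Fin n) (Fin n) ℂ}
    (hA : A.IsHermitian) {k : Fin n}
    (hsimple : Nat.card {i : Fin n // sortedEigs A i = sortedEigs A k} = 1)
    {f x : Fin n → ℂ} (hf : A *ᵥ f = (sortedEigs A k : ℂ) • f) (hf0 : f ≠ 0)
    (hx : A *ᵥ x = (sortedEigs A k : ℂ) • x) : ∃ c : ℂ, x = c • f := by
  obtain ⟨U, hU', hU, hAU⟩ := hA.exists_unitary_sortedEigs
  have hcoord : ∀ y, A *ᵥ y = (sortedEigs A k : ℂ) • y → ∀ i, i ≠ k → (Uᴴ *ᵥ y) i = 0 := by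
    intro y hy i hi
    have hne : sortedEigs A i ≠ sortedEigs A k := by
      intro he
      have := (Nat.card_eq_one_iff_unique.1 hsimple).1.elim ⟨i, he⟩ ⟨k, rfl⟩
      exact hi (congrArg Subtype.val this)
    have h1 : Uᴴ *ᵥ (A *ᵥ y) =
        Matrix.diagonal (fun i => (sortedEigs A i : ℂ)) *ᵥ (Uᴴ *ᵥ y) := by
      conv_lhs => rw [hAU]
      rw [mulVec_mulVec, mulVec_mulVec, ← mul_assoc, ← mul_assoc, hU', one_mul]
    have h2 := congrFun h1 i
    rw [hy, mulVec_smul, mulVec_diagonal, Pi.smul_apply, smul_eq_mul] at h2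
    have h3 : ((sortedEigs A k : ℂ) - sortedEigs A i) * (Uᴴ *ᵥ y) i = 0 := by
      rw [sub_mul, h2, sub_self]
    refine (mul_eq_zero.1 h3).resolve_left ?_
    exact sub_ne_zero.2 (by exact_mod_cast hne.symm)
  have hrep : ∀ y, A *ᵥ y = (sortedEigs A k : ℂ) • y →
      y = (Uᴴ *ᵥ y) k • U *ᵥ Pi.single k 1 := by
    intro y hy
    have : Uᴴ *ᵥ y = (Uᴴ *ᵥ y) k • Pi.single k 1 := by
      ext i
      by_cases hi : i = k
      · simp [hi]
      · simp [hcoord y hy i hi, hi]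
    rw [← mulVec_smul, ← this, mulVec_mulVec, hU, one_mulVec]
  have hk : (Uᴴ *ᵥ f) k ≠ 0 := by
    intro h0
    apply hf0
    rw [hrep f hf, h0, zero_smul]
  refine ⟨(Uᴴ *ᵥ x) k / (Uᴴ *ᵥ f) k, ?_⟩
  calc x = (Uᴴ *ᵥ x) k • U *ᵥ Pi.single k 1 := hrep x hx
    _ = ((Uᴴ *ᵥ x) k / (Uᴴ *ᵥ f) k) • (Uᴴ *ᵥ f) k • U *ᵥ Pi.single k 1 := by
        rw [smul_smul, div_mul_cancel₀ _ hk]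
    _ = _ := by rw [← hrep f hf]

section pinv

variable {m : Type*} [Fintype m] [DecidableEq m] {A : Matrix m m ℂ}

theorem pinvH_isHermitian (A : Matrix m m ℂ) : (pinvH A).IsHermitian := by
  unfold pinvH
  split_ifs with hA
  · rw [star_eq_conjTranspose]
    refine isHermitian_mul_mul_conjTranspose _ ?_
    rw [IsHermitian, diagonal_conjTranspose]
    congr 1
    ext i
    by_cases h : hA.eigenvalues i = 0 <;> simp [h]
  · exact isHermitian_zero

theorem unitary_conj_diagonal_mul {U V : Matrix m m ℂ} (hU : V * U = 1) (a b : m → ℂ) :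
    (U * Matrix.diagonal a * V) * (U * Matrix.diagonal b * V) =
      U * Matrix.diagonal (fun i => a i * b i) * V := by
  rw [← diagonal_mul_diagonal]
  simp only [mul_assoc]
  rw [← mul_assoc V U, hU, one_mul]

theorem mul_mul_pinvH (hA : A.IsHermitian) : A * (A * pinvH A) = A := by
  have hs : A = hA.eigenvectorUnitary * Matrix.diagonal (fun i => (hA.eigenvalues i : ℂ)) *
      star (hA.eigenvectorUnitary : Matrix m m ℂ) := by
    conv_lhs => rw [hA.spectral_theorem, Unitary.conjStarAlgAut_apply]
    rfl
  have hU := Unitary.coe_star_mul_self hA.eigenvectorUnitary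
  have hp : pinvH A = _ := dif_pos hA
  rw [hp]
  generalize (hA.eigenvectorUnitary : Matrix m m ℂ) = U at hs hU ⊢
  generalize hA.eigenvalues = a at hs ⊢
  rw [hs, unitary_conj_diagonal_mul hU, unitary_conj_diagonal_mul hU]
  congr 3
  ext i
  by_cases h : a i = 0 <;> simp [h]

/-- `A A⁺` fixes every vector orthogonal to the null space of `A`. -/
theorem mulVec_pinvH_mulVec_of_orthogonal (hA : A.IsHermitian) {b : m → ℂ}
    (hb : ∀ x, A *ᵥ x = 0 → star x ⬝ᵥ b = 0) : A *ᵥ (pinvH A *ᵥ b) = b := by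
  obtain ⟨e, he⟩ : ∃ e, e = b - A *ᵥ (pinvH A *ᵥ b) := ⟨_, rfl⟩
  have hAe : A *ᵥ e = 0 := by
    rw [he, mulVec_sub, mulVec_mulVec, mulVec_mulVec, mul_assoc, mul_mul_pinvH hA, sub_self]
  have hee : star e ⬝ᵥ e = 0 := by
    have hz : star e ᵥ* A = 0 := by
      rw [← hA.eq, ← star_mulVec, hAe, star_zero]
    nth_rw 2 [he]
    rw [dotProduct_sub, hb e hAe, dotProduct_mulVec, hz, zero_dotProduct, sub_zero]
  have := dotProduct_star_self_eq_zero.1 hee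
  exact (sub_eq_zero.1 (he.symm.trans this)).symm

end pinv

/-- Completing the square in the block form with diagonal blocks `S`, `Ω` and off-diagonal block
`B`, in terms of the Schur complement `Ω - Bᴴ P B`. -/
theorem block_form_eq_schur {m k : Type*} [Fintype m] [Fintype k]
    {S P : Matrix m m ℂ} (hS : S.IsHermitian) (hP : P.IsHermitian) (B : Matrix m k ℂ)
    (Ω : Matrix k k ℂ) (x : m → ℂ) (y : k → ℂ) (hSPB : S *ᵥ (P *ᵥ (B *ᵥ y)) = B *ᵥ y) :
    star (x + P *ᵥ (B *ᵥ y)) ⬝ᵥ S *ᵥ (x + P *ᵥ (B *ᵥ y)) + star y ⬝ᵥ (Ω - Bᴴ * P * B) *ᵥ y =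
      star x ⬝ᵥ S *ᵥ x + star x ⬝ᵥ B *ᵥ y + star (B *ᵥ y) ⬝ᵥ x + star y ⬝ᵥ Ω *ᵥ y := by
  have h1 : star (P *ᵥ (B *ᵥ y)) ⬝ᵥ S *ᵥ x = star (B *ᵥ y) ⬝ᵥ x := by
    rw [dotProduct_mulVec, ← hS.eq, ← star_mulVec, hSPB]
  have h2 : star (P *ᵥ (B *ᵥ y)) ⬝ᵥ B *ᵥ y = star y ⬝ᵥ (Bᴴ * P * B) *ᵥ y := by
    rw [star_mulVec, hP.eq, star_mulVec, vecMul_vecMul, ← dotProduct_mulVec, mulVec_mulVec]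
  rw [mulVec_add, hSPB, star_add, add_dotProduct, dotProduct_add, dotProduct_add, h1, h2,
    sub_mulVec, dotProduct_sub]
  ring

/-- One crossing edge: the change of its quadratic form under the phase `e` is the contribution of
the auxiliary variable `I * (1 - e) * (q / b)` to the block form. -/
theorem edge_form_eq {g e a b : ℂ} (he : Complex.normSq e = 1) (hb : b ≠ 0)
    (hr : (g * b * (starRingEnd ℂ) a).im = 0) (p q : ℂ) :
    2 * (Complex.I * (1 - e) / b * q *
        (Complex.I * (g * b * (starRingEnd ℂ) p -
          (starRingEnd ℂ) g * a * (starRingEnd ℂ) q))).re +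
      (-(g * b * (starRingEnd ℂ) a)).re * Complex.normSq (Complex.I * (1 - e) / b * q) =
    2 * (g * (e - 1) * q * (starRingEnd ℂ) p).re := by
  obtain ⟨s, rfl⟩ : ∃ s, q = b * s := ⟨q / b, by field_simp⟩
  have hy : Complex.I * (1 - e) / b * (b * s) = Complex.I * (1 - e) * s := by field_simp
  have hconj : (starRingEnd ℂ) g * a * (starRingEnd ℂ) b = g * b * (starRingEnd ℂ) a := by
    rw [← Complex.conj_eq_iff_im.2 hr]
    simp only [map_mul, Complex.conj_conj]
    ring
  obtain ⟨r, hr'⟩ : ∃ r : ℝ, g * b * (starRingEnd ℂ) a = r :=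
    ⟨_, (Complex.conj_eq_iff_re.1 (Complex.conj_eq_iff_im.2 hr)).symm⟩
  rw [hr'] at hconj ⊢
  have hexp : Complex.I * (1 - e) * s * (Complex.I * (g * b * (starRingEnd ℂ) p -
      (starRingEnd ℂ) g * a * (starRingEnd ℂ) (b * s))) =
      g * (e - 1) * (b * s) * (starRingEnd ℂ) p +
        (1 - e) * (r * (s * (starRingEnd ℂ) s)) := by
    rw [map_mul, ← hconj]
    linear_combination ((1 - e) * s * (g * b * (starRingEnd ℂ) p -
      (starRingEnd ℂ) g * a * ((starRingEnd ℂ) b * (starRingEnd ℂ) s))) * Complex.I_mul_I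
  rw [hy, hexp, Complex.mul_conj, Complex.normSq_mul, Complex.normSq_mul, Complex.normSq_I,
    Complex.add_re]
  have h1e : Complex.normSq (1 - e) = 2 * (1 - e).re := by
    rw [Complex.normSq_apply] at he ⊢
    simp only [Complex.sub_re, Complex.sub_im, Complex.one_re, Complex.one_im]
    linear_combination he
  rw [h1e, ← Complex.ofReal_mul, Complex.re_mul_ofReal, Complex.neg_re, Complex.ofReal_re]
  ring

/-- A linear auxiliary variable for a crossing edge, depending on one endpoint value. -/
theorem exists_edge_variable {N : Type*} {g e : ℂ} {f : N → ℂ} {u v : N}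
    (he : Complex.normSq e = 1) (hf : f u ≠ 0 ∨ f v ≠ 0)
    (hr : (g * f v * (starRingEnd ℂ) (f u)).im = 0) :
    ∃ (w : N) (c : ℂ), ∀ x : N → ℂ,
      2 * (c * x w * (Complex.I * (g * f v * (starRingEnd ℂ) (x u) -
          (starRingEnd ℂ) g * f u * (starRingEnd ℂ) (x v)))).re +
        (-(g * f v * (starRingEnd ℂ) (f u))).re * Complex.normSq (c * x w) =
      2 * (g * (e - 1) * x v * (starRingEnd ℂ) (x u)).re := by
  rcases hf with hu | hv
  · refine ⟨u, -(Complex.I * (1 - (starRingEnd ℂ) e) / f u), fun x => ?_⟩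
    have hconj : (starRingEnd ℂ) g * f u * (starRingEnd ℂ) (f v) =
        g * f v * (starRingEnd ℂ) (f u) := by
      rw [← Complex.conj_eq_iff_im.2 hr]
      simp only [map_mul, Complex.conj_conj]
      ring
    have h := edge_form_eq (g := (starRingEnd ℂ) g) (e := (starRingEnd ℂ) e) (a := f v) (b := f u)
      (by rwa [Complex.normSq_conj]) hu (by rwa [hconj]) (x v) (x u)
    rw [hconj, Complex.conj_conj] at h
    have hre : ((starRingEnd ℂ) g * ((starRingEnd ℂ) e - 1) * x u * (starRingEnd ℂ) (x v)).re =
        (g * (e - 1) * x v * (starRingEnd ℂ) (x u)).re := by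
      rw [← Complex.conj_re]
      simp only [map_mul, map_sub, map_one, Complex.conj_conj]
      congr 1
      ring
    rw [← hre, ← h, neg_mul, Complex.normSq_neg]
    congr 3
    ring
  · exact ⟨v, _, fun x => edge_form_eq he hv hr (x u) (x v)⟩

theorem isHermitian_single_add_single {N : Type*} [DecidableEq N] (u v : N) (g : ℂ) :
    (Matrix.single u v g + Matrix.single v u ((starRingEnd ℂ) g)).IsHermitian := by
  rw [IsHermitian, conjTranspose_add, conjTranspose_single, conjTranspose_single, add_comm]
  simp

theorem re_star_dotProduct_edge_mulVec {N : Type*} [Fintype N] [DecidableEq N]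
    (u v : N) (g : ℂ) (x : N → ℂ) :
    (star x ⬝ᵥ (Matrix.single u v g + Matrix.single v u ((starRingEnd ℂ) g)) *ᵥ x).re =
      2 * (g * x v * (starRingEnd ℂ) (x u)).re := by
  rw [add_mulVec, dotProduct_add, single_mulVec_eq, single_mulVec_eq, dotProduct_smul,
    dotProduct_smul, dotProduct_single_one, dotProduct_single_one, Complex.add_re]
  simp
  ring

/-- Theorem 1.3(1) of the paper: for the Floquet–Bloch family `T(α)` of a periodic graph
with one crossing edge per generator, if `α°` is a critical point of the `n`-th band,
the eigenvalue is simple with unit eigenvector nonvanishing on crossing edges, and the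
test matrix `W` is positive semidefinite, then `α°` is a global minimum of the band. -/
theorem global_min_of_W_posSemidef
    (d N : ℕ) (hd : 0 < d) (hN : 0 < N)
    (u v : Fin d → Fin N) (h : Fin d → ℂ) (hh : ∀ j, h j ≠ 0)
    (T0 : Matrix (Fin N) (Fin N) ℂ) (hT0 : T0.IsHermitian)
    (T : (Fin d → ℝ) → Matrix (Fin N) (Fin N) ℂ)
    (hT : ∀ α : Fin d → ℝ, T α = T0 + ∑ j : Fin d,
      (Matrix.single (u j) (v j) (h j * Complex.exp (Complex.I * (α j : ℂ))) +
       Matrix.single (v j) (u j)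
         ((starRingEnd ℂ) (h j) * Complex.exp (-(Complex.I * (α j : ℂ))))))
    (n : Fin N)
    (α0 : Fin d → ℝ) (f : Fin N → ℂ)
    (hsimple : Nat.card {i : Fin N // sortedEigs (T α0) i = sortedEigs (T α0) n} = 1)
    (hunit : star f ⬝ᵥ f = (1 : ℂ))
    (heig : (T α0).mulVec f = ((sortedEigs (T α0) n : ℝ) : ℂ) • f)
    (hcrit : ∀ j, (h j * Complex.exp (Complex.I * (α0 j : ℂ)) * f (v j) *
      (starRingEnd ℂ) (f (u j))).im = 0)
    (hnv : ∀ j, f (u j) ≠ 0 ∨ f (v j) ≠ 0)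
    (B : Matrix (Fin N) (Fin d) ℂ)
    (hB : B = Matrix.of fun i j => Complex.I *
      (h j * Complex.exp (Complex.I * (α0 j : ℂ)) * f (v j) * (if i = u j then 1 else 0) -
       (starRingEnd ℂ) (h j) * Complex.exp (-(Complex.I * (α0 j : ℂ))) * f (u j) *
         (if i = v j then 1 else 0)))
    (Ω : Matrix (Fin d) (Fin d) ℂ)
    (hΩ : Ω = Matrix.diagonal fun j =>
      (((-(h j * Complex.exp (Complex.I * (α0 j : ℂ)) * f (v j) *
        (starRingEnd ℂ) (f (u j)))).re : ℝ) : ℂ))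
    (W : Matrix (Fin d) (Fin d) ℂ)
    (hW : W = Ω - Bᴴ * pinvH (T α0 - ((sortedEigs (T α0) n : ℝ) : ℂ) •
      (1 : Matrix (Fin N) (Fin N) ℂ)) * B)
    (hWpsd : W.PosSemidef) :
    ∀ α : Fin d → ℝ, sortedEigs (T α0) n ≤ sortedEigs (T α) n := by
  have hexp : ∀ (a : ℝ) (z : ℂ), (starRingEnd ℂ) z * Complex.exp (-(Complex.I * (a : ℂ))) =
      (starRingEnd ℂ) (z * Complex.exp (Complex.I * (a : ℂ))) := by
    intro a z
    rw [map_mul, ← Complex.exp_conj]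
    simp
  simp only [hexp] at hT hB
  have hherm : ∀ α, (T α).IsHermitian := by
    intro α
    rw [hT]
    exact hT0.add (isSelfAdjoint_sum _ fun j _ => isHermitian_single_add_single _ _ _)
  have hform : ∀ α x, (star x ⬝ᵥ T α *ᵥ x).re = (star x ⬝ᵥ T0 *ᵥ x).re +
      ∑ j, 2 * (h j * Complex.exp (Complex.I * (α j : ℂ)) * x (v j) *
        (starRingEnd ℂ) (x (u j))).re := by
    intro α x
    rw [hT, add_mulVec, dotProduct_add, sum_mulVec, dotProduct_sum, Complex.add_re, Complex.re_sum]
    simp only [re_star_dotProduct_edge_mulVec]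
  have hf0 : f ≠ 0 := by
    rintro rfl
    simp at hunit
  set c := sortedEigs (T α0) n with hc
  set S := T α0 - (c : ℂ) • (1 : Matrix (Fin N) (Fin N) ℂ) with hS
  have hSherm : S.IsHermitian := by
    refine (hherm α0).sub ?_
    rw [IsHermitian, conjTranspose_smul, conjTranspose_one]
    simp
  have hfB : ∀ j, star f ⬝ᵥ (fun i => B i j) = 0 := by
    intro j
    have hz := Complex.conj_eq_iff_im.2 (hcrit j)
    simp only [map_mul, Complex.conj_conj] at hz
    simp only [hB, dotProduct, Matrix.of_apply, Pi.star_apply, RCLike.star_def, mul_sub, mul_ite,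
      mul_one, mul_zero, Finset.sum_sub_distrib, Finset.sum_ite_eq',
      Finset.mem_univ, if_true, map_mul]
    linear_combination -Complex.I * hz
  have hSPB : ∀ y, S *ᵥ (pinvH S *ᵥ (B *ᵥ y)) = B *ᵥ y := by
    intro y
    refine mulVec_pinvH_mulVec_of_orthogonal hSherm fun x hx => ?_
    rw [hS, sub_mulVec, smul_mulVec, one_mulVec, sub_eq_zero] at hx
    obtain ⟨k, rfl⟩ := (hherm α0).exists_eq_smul_of_simple hsimple heig hf0 hx
    have hfB' : star f ᵥ* B = 0 := funext hfB
    rw [star_smul, smul_dotProduct, dotProduct_mulVec, hfB', zero_dotProduct, smul_zero]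
  intro α
  have hedge := fun j => exists_edge_variable (f := f) (u := u j) (v := v j)
    (g := h j * Complex.exp (Complex.I * (α0 j : ℂ)))
    (e := Complex.exp (Complex.I * ((α j - α0 j : ℝ) : ℂ)))
    (by rw [Complex.normSq_eq_norm_sq, mul_comm, Complex.norm_exp_ofReal_mul_I, one_pow])
    (hnv j) (hcrit j)
  choose w a hwa using hedge
  let Y : (Fin N → ℂ) →ₗ[ℂ] (Fin d → ℂ) := LinearMap.pi fun j => a j • LinearMap.proj (w j)
  have hY : ∀ x j, Y x j = a j * x (w j) := fun x j => rfl
  refine sortedEigs_le_of_comap_le (hherm α) (hherm α0) n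
    (LinearMap.id + (pinvH S).mulVecLin ∘ₗ B.mulVecLin ∘ₗ Y) fun x => ?_
  simp only [LinearMap.add_apply, LinearMap.id_apply, LinearMap.comp_apply, mulVecLin_apply]
  rw [← hc, ← hS]
  have hsq := congrArg Complex.re
    (block_form_eq_schur hSherm (pinvH_isHermitian S) B Ω x (Y x) (hSPB (Y x)))
  have hpos := (Complex.le_def.1 (hWpsd.dotProduct_mulVec_nonneg (Y x))).1
  have hB1 : (star x ⬝ᵥ B *ᵥ Y x).re = ∑ j, (a j * x (w j) * (Complex.I *
      (h j * Complex.exp (Complex.I * (α0 j : ℂ)) * f (v j) * (starRingEnd ℂ) (x (u j)) -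
        (starRingEnd ℂ) (h j * Complex.exp (Complex.I * (α0 j : ℂ))) * f (u j) *
          (starRingEnd ℂ) (x (v j))))).re := by
    rw [dotProduct_mulVec, dotProduct, Complex.re_sum]
    refine Finset.sum_congr rfl fun j _ => congrArg Complex.re ?_
    rw [hY, mul_comm]
    congr 1
    simp only [hB, vecMul, dotProduct, Matrix.of_apply, Pi.star_apply, RCLike.star_def, mul_sub,
      mul_ite, mul_one, mul_zero, Finset.sum_sub_distrib, Finset.sum_ite_eq',
      Finset.mem_univ, if_true]
    ring
  have hB2 : (star (B *ᵥ Y x) ⬝ᵥ x).re = (star x ⬝ᵥ B *ᵥ Y x).re := by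
    rw [star_dotProduct, RCLike.star_def, Complex.conj_re]
  have hΩ1 : (star (Y x) ⬝ᵥ Ω *ᵥ Y x).re = ∑ j,
      (-(h j * Complex.exp (Complex.I * (α0 j : ℂ)) * f (v j) * (starRingEnd ℂ) (f (u j)))).re *
        Complex.normSq (a j * x (w j)) := by
    rw [dotProduct, Complex.re_sum]
    refine Finset.sum_congr rfl fun j _ => ?_
    rw [hΩ, mulVec_diagonal, hY, Pi.star_apply, hY, mul_left_comm, Complex.re_ofReal_mul,
      RCLike.star_def, ← Complex.normSq_eq_conj_mul_self, Complex.ofReal_re]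
  have hdiff : (star x ⬝ᵥ (T α - (c : ℂ) • (1 : Matrix (Fin N) (Fin N) ℂ)) *ᵥ x).re =
      (star x ⬝ᵥ S *ᵥ x).re + ∑ j, 2 * (h j * Complex.exp (Complex.I * (α0 j : ℂ)) *
        (Complex.exp (Complex.I * ((α j - α0 j : ℝ) : ℂ)) - 1) * x (v j) *
          (starRingEnd ℂ) (x (u j))).re := by
    rw [hS, sub_mulVec, sub_mulVec, dotProduct_sub, dotProduct_sub, Complex.sub_re, Complex.sub_re,
      hform, hform]
    have : ∀ j, 2 * (h j * Complex.exp (Complex.I * (α j : ℂ)) * x (v j) *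
        (starRingEnd ℂ) (x (u j))).re = 2 * (h j * Complex.exp (Complex.I * (α0 j : ℂ)) * x (v j) *
        (starRingEnd ℂ) (x (u j))).re + 2 * (h j * Complex.exp (Complex.I * (α0 j : ℂ)) *
        (Complex.exp (Complex.I * ((α j - α0 j : ℝ) : ℂ)) - 1) * x (v j) *
          (starRingEnd ℂ) (x (u j))).re := by
      intro j
      rw [← mul_add, ← Complex.add_re]
      have hadd : Complex.exp (Complex.I * (α j : ℂ)) = Complex.exp (Complex.I * (α0 j : ℂ)) *
          Complex.exp (Complex.I * ((α j - α0 j : ℝ) : ℂ)) := by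
        rw [← Complex.exp_add]
        push_cast
        ring_nf
      rw [hadd]
      ring_nf
    rw [Finset.sum_congr rfl fun j _ => this j, Finset.sum_add_distrib]
    ring
  rw [hdiff, ← Finset.sum_congr rfl fun j _ => hwa j x, Finset.sum_add_distrib, ← hΩ1,
    ← Finset.mul_sum, ← hB1]
  rw [hW, Complex.zero_re] at hpos
  simp only [Complex.add_re] at hsq
  rw [hB2] at hsq
  linarith
end
end

section
/- Suppose α° is a critical point of λ and λ(α°) is a simple eigenvalue with unit eigenvector f°. Let J' = {j : f°_{u_j} f°_{v_j} ≠ 0} and J'' = {j : f°_{u_j} f°_{v_j} = 0}, and let P be the orthogonal projection onto Null(Ω). Then B Ω⁺ B* = Σ_{j ∈ J'} ( (Ω_{jj}/|f°_{u_j}|²) E_{u_j,u_j} + h_j e^{iα°_j} E_{u_j,v_j} + conj(h_j) e^{-iα°_j} E_{v_j,u_j} + (Ω_{jj}/|f°_{v_j}|²) E_{v_j,v_j} ), and B P B* = Σ_{j ∈ J''} |h_j|² ( |f°_{v_j}|² E_{u_j,u_j} + |f°_{u_j}|² E_{v_j,v_j} ). Consequently, if f° is non-vanishing on crossing edges, the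 range of BPB* is spanned by { e_{u_j} : f°_{u_j} = 0, f°_{v_j} ≠ 0 } ∪ { e_{v_j} : f°_{v_j} = 0, f°_{u_j} ≠ 0 }. -/
noncomputable section

open Matrix Complex
open scoped ComplexOrder

/-- The pseudoinverse of a real diagonal matrix is obtained by inverting the diagonal entries
(with `0⁻¹ = 0`). -/
lemma pinvH_diagonal {m : Type*} [Fintype m] [DecidableEq m] (a : m → ℝ) :
    pinvH (Matrix.diagonal fun j => (a j : ℂ)) = Matrix.diagonal fun j => ((a j : ℂ))⁻¹ := by
  have hA : (Matrix.diagonal fun j => (a j : ℂ)).IsHermitian :=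
    Matrix.isHermitian_diagonal_of_self_adjoint _ (by ext j; simp)
  rw [pinvH, dif_pos hA]
  set U : Matrix m m ℂ := (hA.eigenvectorUnitary : Matrix m m ℂ) with hU
  have hUU : U * star U = 1 := Unitary.coe_mul_star_self hA.eigenvectorUnitary
  have hentry : ∀ i j, (a i : ℂ) * U i j = (hA.eigenvalues j : ℂ) * U i j := by
    intro i j
    have := congrFun (hA.mulVec_eigenvectorBasis j) i
    simpa [Matrix.mulVec_diagonal, hU, Matrix.IsHermitian.eigenvectorUnitary_apply] using this
  have hcomm : U * Matrix.diagonal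
      (fun i => if hA.eigenvalues i = 0 then 0 else ((hA.eigenvalues i : ℂ))⁻¹) =
      (Matrix.diagonal fun j => ((a j : ℂ))⁻¹) * U := by
    ext i j
    rw [Matrix.mul_diagonal, Matrix.diagonal_mul]
    have hinv : (if hA.eigenvalues j = 0 then 0 else ((hA.eigenvalues j : ℂ))⁻¹) =
        ((hA.eigenvalues j : ℂ))⁻¹ := by
      split_ifs with h0 <;> simp [h0]
    rw [hinv]
    by_cases hz : U i j = 0
    · simp [hz]
    · rw [mul_right_cancel₀ hz (hentry i j), mul_comm]
  rw [hcomm, Matrix.mul_assoc, hUU, Matrix.mul_one]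

/-- The orthogonal projection onto the null space of a real diagonal matrix. -/
lemma nullProj_diagonal {m : Type*} [Fintype m] [DecidableEq m] (a : m → ℝ) :
    nullProj (Matrix.diagonal fun j => (a j : ℂ)) =
      Matrix.diagonal fun j => if a j = 0 then (1 : ℂ) else 0 := by
  rw [nullProj, pinvH_diagonal, Matrix.diagonal_mul_diagonal, ← Matrix.diagonal_one,
    Matrix.diagonal_sub]
  congr 1
  ext j
  by_cases h0 : a j = 0 <;> simp [h0]

/-- Expansion of `B D Bᴴ`, for `D` diagonal and `B` with columns supported on two entries,
into matrix units. -/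
lemma mul_diagonal_mul_conjTranspose_eq_sum_single {ι κ : Type*} [Fintype κ]
    [DecidableEq ι] [DecidableEq κ] (u v : κ → ι) (x y g : κ → ℂ) :
    (Matrix.of fun i j => x j * (if i = u j then 1 else 0) + y j * (if i = v j then 1 else 0)) *
        Matrix.diagonal g *
        (Matrix.of fun i j =>
          x j * (if i = u j then 1 else 0) + y j * (if i = v j then 1 else 0))ᴴ =
      ∑ j, (Matrix.single (u j) (u j) (g j * (x j * star (x j))) +
        Matrix.single (u j) (v j) (g j * (x j * star (y j))) +
        Matrix.single (v j) (u j) (g j * (y j * star (x j))) +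
        Matrix.single (v j) (v j) (g j * (y j * star (y j)))) := by
  ext p q
  rw [Matrix.mul_apply, Matrix.sum_apply]
  refine Finset.sum_congr rfl fun j _ => ?_
  simp only [Matrix.mul_diagonal, Matrix.of_apply, Matrix.conjTranspose_apply, Matrix.add_apply,
    Matrix.single_apply, star_add, star_mul', apply_ite star, star_one, star_zero,
    eq_comm (a := u j), eq_comm (a := v j), ite_and]
  split_ifs <;> ring

/-- The range of a diagonal matrix is spanned by the basis vectors at its nonzero entries. -/
lemma range_mulVecLin_diagonal {ι : Type*} [Fintype ι] [DecidableEq ι] (D : ι → ℂ) :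
    LinearMap.range (Matrix.diagonal D).mulVecLin =
      Submodule.span ℂ {w : ι → ℂ | ∃ i, D i ≠ 0 ∧ w = Pi.single i 1} := by
  apply le_antisymm
  · rintro _ ⟨w, rfl⟩
    rw [Matrix.mulVecLin_apply, pi_eq_sum_univ' (Matrix.diagonal D *ᵥ w)]
    refine Submodule.sum_mem _ fun i _ => ?_
    rw [Matrix.mulVec_diagonal]
    by_cases h0 : D i = 0
    · simp [h0]
    · refine Submodule.smul_mem _ _ (Submodule.subset_span ⟨i, h0, ?_⟩)
      ext k
      simp [Pi.single_apply, eq_comm]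
  · rw [Submodule.span_le]
    rintro _ ⟨i, h0, rfl⟩
    refine ⟨Pi.single i (D i)⁻¹, ?_⟩
    ext k
    rw [Matrix.mulVecLin_apply, Matrix.mulVec_diagonal]
    by_cases hk : k = i
    · subst hk; simp [h0]
    · simp [hk]

/-- The range of a sum of nonnegative multiples of diagonal matrix units is spanned by the basis
vectors at which some coefficient is nonzero. -/
lemma range_mulVecLin_sum_single {ι κ : Type*} [Fintype ι] [DecidableEq ι]
    (s : Finset κ) (u v : κ → ι) (x y : κ → ℝ) (hx : ∀ j, 0 ≤ x j) (hy : ∀ j, 0 ≤ y j) :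
    LinearMap.range (∑ j ∈ s, (Matrix.single (u j) (u j) (x j : ℂ) +
        Matrix.single (v j) (v j) (y j : ℂ))).mulVecLin =
      Submodule.span ℂ ({w : ι → ℂ | ∃ j ∈ s, x j ≠ 0 ∧ w = Pi.single (u j) 1} ∪
        {w : ι → ℂ | ∃ j ∈ s, y j ≠ 0 ∧ w = Pi.single (v j) 1}) := by
  set r : ι → κ → ℝ := fun i j => (if u j = i then x j else 0) + (if v j = i then y j else 0)
    with hr
  have hdiag : ∑ j ∈ s, (Matrix.single (u j) (u j) (x j : ℂ) +
      Matrix.single (v j) (v j) (y j : ℂ)) =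
      Matrix.diagonal fun i => ((∑ j ∈ s, r i j : ℝ) : ℂ) := by
    ext p q
    rw [Matrix.sum_apply, Matrix.diagonal_apply]
    split_ifs with hpq
    · subst hpq
      push_cast
      refine Finset.sum_congr rfl fun j _ => ?_
      simp [hr, Matrix.single_apply, apply_ite Complex.ofReal]
    · refine Finset.sum_eq_zero fun j _ => ?_
      have hsingle : ∀ (k : ι) (c : ℂ), Matrix.single k k c p q = 0 := fun k c =>
        Matrix.single_apply_of_ne _ _ _ _ _ fun hk => hpq (hk.1.symm.trans hk.2)
      simp [hsingle]
  have hx' : ∀ i j, 0 ≤ if u j = i then x j else 0 := fun i j => ite_nonneg (hx j) le_rfl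
  have hy' : ∀ i j, 0 ≤ if v j = i then y j else 0 := fun i j => ite_nonneg (hy j) le_rfl
  have hne : ∀ i, ((∑ j ∈ s, r i j : ℝ) : ℂ) ≠ 0 ↔
      ∃ j ∈ s, (u j = i ∧ x j ≠ 0) ∨ (v j = i ∧ y j ≠ 0) := by
    intro i
    rw [Complex.ofReal_ne_zero, Ne,
      Finset.sum_eq_zero_iff_of_nonneg fun j _ => add_nonneg (hx' i j) (hy' i j)]
    simp only [add_eq_zero_iff_of_nonneg (hx' i _) (hy' i _)]
    push Not
    refine exists_congr fun j => and_congr_right fun _ => ?_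
    by_cases h1 : u j = i <;> by_cases h2 : v j = i <;> simp [h1, h2]
    tauto
  rw [hdiag, range_mulVecLin_diagonal]
  congr 1
  ext w
  simp only [hne, Set.mem_ofPred_eq, Set.mem_union]
  constructor
  · rintro ⟨i, ⟨j, hj, ⟨rfl, h0⟩ | ⟨rfl, h0⟩⟩, rfl⟩
    · exact Or.inl ⟨j, hj, h0, rfl⟩
    · exact Or.inr ⟨j, hj, h0, rfl⟩
  · rintro (⟨j, hj, h0, rfl⟩ | ⟨j, hj, h0, rfl⟩)
    · exact ⟨_, ⟨j, hj, Or.inl ⟨rfl, h0⟩⟩, rfl⟩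
    · exact ⟨_, ⟨j, hj, Or.inr ⟨rfl, h0⟩⟩, rfl⟩

/-- Lemma 2.10 of the paper: at a critical point, explicit formulas for `B Ω⁺ B*` and
`B P B*` (`P` the orthogonal projection onto `Null(Ω)`), and the description of the
range of `B P B*` when the eigenvector is non-vanishing on crossing edges. -/
theorem BOmegaPinvBstar_and_BPBstar_formulas
    (d N : ℕ) (hd : 0 < d) (hN : 0 < N)
    (u v : Fin d → Fin N) (h : Fin d → ℂ) (hh : ∀ j, h j ≠ 0)
    (T0 : Matrix (Fin N) (Fin N) ℂ) (hT0 : T0.IsHermitian)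
    (T : (Fin d → ℝ) → Matrix (Fin N) (Fin N) ℂ)
    (hT : ∀ α : Fin d → ℝ, T α = T0 + ∑ j : Fin d,
      (Matrix.single (u j) (v j) (h j * Complex.exp (Complex.I * (α j : ℂ))) +
       Matrix.single (v j) (u j)
         ((starRingEnd ℂ) (h j) * Complex.exp (-(Complex.I * (α j : ℂ))))))
    (n : Fin N)
    (α0 : Fin d → ℝ) (f : Fin N → ℂ)
    (hsimple : Nat.card {i : Fin N // sortedEigs (T α0) i = sortedEigs (T α0) n} = 1)
    (hunit : star f ⬝ᵥ f = (1 : ℂ))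
    (heig : (T α0).mulVec f = ((sortedEigs (T α0) n : ℝ) : ℂ) • f)
    (hcrit : ∀ j, (h j * Complex.exp (Complex.I * (α0 j : ℂ)) * f (v j) *
      (starRingEnd ℂ) (f (u j))).im = 0)
    (B : Matrix (Fin N) (Fin d) ℂ)
    (hB : B = Matrix.of fun i j => Complex.I *
      (h j * Complex.exp (Complex.I * (α0 j : ℂ)) * f (v j) * (if i = u j then 1 else 0) -
       (starRingEnd ℂ) (h j) * Complex.exp (-(Complex.I * (α0 j : ℂ))) * f (u j) *
         (if i = v j then 1 else 0)))
    (Ω : Matrix (Fin d) (Fin d) ℂ)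
    (hΩ : Ω = Matrix.diagonal fun j =>
      (((-(h j * Complex.exp (Complex.I * (α0 j : ℂ)) * f (v j) *
        (starRingEnd ℂ) (f (u j)))).re : ℝ) : ℂ))
    (P : Matrix (Fin d) (Fin d) ℂ) (hP : P = nullProj Ω) :
    (B * pinvH Ω * Bᴴ =
      ∑ j : Fin d with f (u j) * f (v j) ≠ 0,
        (Matrix.single (u j) (u j)
            ((((-(h j * Complex.exp (Complex.I * (α0 j : ℂ)) * f (v j) *
              (starRingEnd ℂ) (f (u j)))).re / Complex.normSq (f (u j)) : ℝ) : ℂ)) +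
         Matrix.single (u j) (v j) (h j * Complex.exp (Complex.I * (α0 j : ℂ))) +
         Matrix.single (v j) (u j)
            ((starRingEnd ℂ) (h j) * Complex.exp (-(Complex.I * (α0 j : ℂ)))) +
         Matrix.single (v j) (v j)
            ((((-(h j * Complex.exp (Complex.I * (α0 j : ℂ)) * f (v j) *
              (starRingEnd ℂ) (f (u j)))).re / Complex.normSq (f (v j)) : ℝ) : ℂ)))) ∧
    (B * P * Bᴴ =
      ∑ j : Fin d with f (u j) * f (v j) = 0,
        (Matrix.single (u j) (u j)
            ((Complex.normSq (h j) * Complex.normSq (f (v j)) : ℝ) : ℂ) +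
         Matrix.single (v j) (v j)
            ((Complex.normSq (h j) * Complex.normSq (f (u j)) : ℝ) : ℂ))) ∧
    ((∀ j, f (u j) ≠ 0 ∨ f (v j) ≠ 0) →
      LinearMap.range (B * P * Bᴴ).mulVecLin =
        Submodule.span ℂ
          ({w : Fin N → ℂ | ∃ j, f (u j) = 0 ∧ f (v j) ≠ 0 ∧ w = Pi.single (u j) 1} ∪
           {w : Fin N → ℂ | ∃ j, f (v j) = 0 ∧ f (u j) ≠ 0 ∧ w = Pi.single (v j) 1})) := by
  set a : Fin d → ℂ := fun j => h j * Complex.exp (Complex.I * (α0 j : ℂ)) with ha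
  set ω : Fin d → ℝ := fun j => (-(a j * f (v j) * star (f (u j)))).re with hω_def
  have ha0 : ∀ j, a j ≠ 0 := fun j => mul_ne_zero (hh j) (Complex.exp_ne_zero _)
  have hstar : ∀ j, (starRingEnd ℂ) (h j) * Complex.exp (-(Complex.I * (α0 j : ℂ))) =
      star (a j) := by
    intro j
    simp [ha, ← Complex.exp_conj]
  have hnorm : ∀ j, ((Complex.normSq (h j) : ℝ) : ℂ) = a j * star (a j) := by
    intro j
    rw [← hstar, ← Complex.mul_conj]
    simp only [ha]
    rw [Complex.exp_neg]
    field_simp [Complex.exp_ne_zero]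
  have hω : ∀ j, (ω j : ℂ) = -(a j * f (v j) * star (f (u j))) := by
    intro j
    apply Complex.ext
    · simp [hω_def]
    · have := hcrit j
      simp only [ofReal_im, neg_im]
      exact (neg_eq_zero.mpr this).symm
  have hω' : ∀ j, (ω j : ℂ) = -(star (a j) * star (f (v j)) * f (u j)) := by
    intro j
    simpa using congrArg star (hω j)
  have hω0 : ∀ j, ω j = 0 ↔ f (u j) * f (v j) = 0 := by
    intro j
    rw [← Complex.ofReal_eq_zero, hω]
    simp [ha0 j, or_comm]
  have hΩ' : Ω = Matrix.diagonal fun j => (ω j : ℂ) := hΩ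
  have hB' : B = Matrix.of fun i j => Complex.I * a j * f (v j) * (if i = u j then 1 else 0) +
      -(Complex.I * star (a j) * f (u j)) * (if i = v j then 1 else 0) := by
    rw [hB]
    ext i j
    simp only [Matrix.of_apply, hstar]
    ring
  have hII : Complex.I ^ 2 = -1 := Complex.I_sq
  have hformula : B * P * Bᴴ = ∑ j : Fin d with f (u j) * f (v j) = 0,
      (Matrix.single (u j) (u j)
          ((Complex.normSq (h j) * Complex.normSq (f (v j)) : ℝ) : ℂ) +
        Matrix.single (v j) (v j)
          ((Complex.normSq (h j) * Complex.normSq (f (u j)) : ℝ) : ℂ)) := by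
    rw [hP, hΩ', nullProj_diagonal, hB', mul_diagonal_mul_conjTranspose_eq_sum_single,
      Finset.sum_filter]
    refine Finset.sum_congr rfl fun j _ => ?_
    by_cases h0 : f (u j) * f (v j) = 0
    · rw [if_pos h0, if_pos ((hω0 j).mpr h0)]
      push_cast
      rw [hnorm, ← Complex.mul_conj (f (u j)), ← Complex.mul_conj (f (v j))]
      rcases mul_eq_zero.mp h0 with hz | hz
      · simp [hz]
        congr 1
        linear_combination
          (-(a j * f (v j) * (starRingEnd ℂ) (a j) * (starRingEnd ℂ) (f (v j)))) * hII
      · simp [hz]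
        congr 1
        linear_combination
          (-(a j * f (u j) * (starRingEnd ℂ) (a j) * (starRingEnd ℂ) (f (u j)))) * hII
    · rw [if_neg h0, if_neg (fun hz => h0 ((hω0 j).mp hz))]
      simp
  refine ⟨?_, hformula, fun _ => ?_⟩
  · rw [hΩ', pinvH_diagonal, hB', mul_diagonal_mul_conjTranspose_eq_sum_single,
      Finset.sum_filter]
    refine Finset.sum_congr rfl fun j _ => ?_
    by_cases h0 : f (u j) * f (v j) = 0
    · rw [if_neg (not_not.mpr h0), (hω0 j).mpr h0]
      simp
    · rw [if_pos h0, hstar]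
      obtain ⟨hu, hv⟩ := mul_ne_zero_iff.mp h0
      have hωj : (ω j : ℂ) ≠ 0 := Complex.ofReal_ne_zero.mpr fun hz => h0 ((hω0 j).mp hz)
      have hsu : star (f (u j)) ≠ 0 := star_ne_zero.mpr hu
      have hsv : star (f (v j)) ≠ 0 := star_ne_zero.mpr hv
      have hdiv : ∀ z : ℂ, ((ω j / Complex.normSq z : ℝ) : ℂ) = ω j / (z * star z) := by
        intro z
        rw [Complex.ofReal_div, ← Complex.mul_conj]
        rfl
      have hstarI : star Complex.I = -Complex.I := Complex.conj_I
      change _ = Matrix.single (u j) (u j) ((ω j / Complex.normSq (f (u j)) : ℝ) : ℂ) +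
        Matrix.single (u j) (v j) (a j) + Matrix.single (v j) (u j) (star (a j)) +
        Matrix.single (v j) (v j) ((ω j / Complex.normSq (f (v j)) : ℝ) : ℂ)
      have h1 := hω j
      have h2 := hω' j
      rw [hdiv, hdiv]
      simp only [star_mul', star_neg, star_star, hstarI]
      congr 2
      · congr 1
        · congr 1
          field_simp
          rw [hII]
          linear_combination (-(ω j : ℂ)) * h1 + a j * f (v j) * star (f (u j)) * h2
        · congr 1
          field_simp
          rw [hII]
          linear_combination -(a j) * h1
      · congr 1
        field_simp
        rw [hII]
        linear_combination -star (a j) * h2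
      · field_simp
        rw [hII]
        linear_combination (-(ω j : ℂ)) * h1 + a j * f (v j) * star (f (u j)) * h2
  · rw [hformula, range_mulVecLin_sum_single _ u v
      (fun j => Complex.normSq (h j) * Complex.normSq (f (v j)))
      (fun j => Complex.normSq (h j) * Complex.normSq (f (u j)))
      (fun j => mul_nonneg (Complex.normSq_nonneg _) (Complex.normSq_nonneg _))
      (fun j => mul_nonneg (Complex.normSq_nonneg _) (Complex.normSq_nonneg _))]
    congr 2
    · ext w
      refine exists_congr fun j => ?_
      simp [hh j]
      tauto
    · ext w
      refine exists_congr fun j => ?_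
      simp [hh j]
      tauto
end
end

section
/- Suppose α° is a critical point of λ and λ(α°) is a simple eigenvalue of T(α°) with unit eigenvector f°. Then f° lies in the subspace 𝒬 and S f° = 0; in particular 0 is an eigenvalue of S. -/
noncomputable section

open Matrix Complex
open scoped ComplexOrder

/-- The pseudoinverse commutes with the matrix. -/
theorem pinvH_mul_self_comm {m : Type*} [Fintype m] [DecidableEq m] (A : Matrix m m ℂ) :
    pinvH A * A = A * pinvH A := by
  by_cases hA : A.IsHermitian
  · have hU : star (hA.eigenvectorUnitary : Matrix m m ℂ) * hA.eigenvectorUnitary = 1 :=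
      Unitary.coe_star_mul_self _
    have hspec : A = (hA.eigenvectorUnitary : Matrix m m ℂ) *
        diagonal (fun i => (hA.eigenvalues i : ℂ)) *
        star (hA.eigenvectorUnitary : Matrix m m ℂ) := hA.spectral_theorem
    have hmul (a b : m → ℂ) : (hA.eigenvectorUnitary : Matrix m m ℂ) * diagonal a *
        star (hA.eigenvectorUnitary : Matrix m m ℂ) *
        ((hA.eigenvectorUnitary : Matrix m m ℂ) * diagonal b *
        star (hA.eigenvectorUnitary : Matrix m m ℂ)) =
        (hA.eigenvectorUnitary : Matrix m m ℂ) * diagonal (fun i => a i * b i) *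
        star (hA.eigenvectorUnitary : Matrix m m ℂ) := by
      rw [← diagonal_mul_diagonal]
      simp only [Matrix.mul_assoc]
      rw [← Matrix.mul_assoc (star (hA.eigenvectorUnitary : Matrix m m ℂ))
        (hA.eigenvectorUnitary : Matrix m m ℂ), hU, Matrix.one_mul]
    have hpinv : pinvH A = (hA.eigenvectorUnitary : Matrix m m ℂ) *
        diagonal (fun i => if hA.eigenvalues i = 0 then 0 else ((hA.eigenvalues i : ℂ))⁻¹) *
        star (hA.eigenvectorUnitary : Matrix m m ℂ) := by
      simp only [pinvH, dif_pos hA]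
    calc pinvH A * A = _ := congrArg₂ (· * ·) hpinv hspec
      _ = _ := hmul _ _
      _ = _ := by simp only [mul_comm]
      _ = _ := (hmul _ _).symm
      _ = A * pinvH A := (congrArg₂ (· * ·) hspec hpinv).symm
  · simp [pinvH, hA]

/-- The pseudoinverse is Hermitian. -/
theorem isHermitian_pinvH {m : Type*} [Fintype m] [DecidableEq m] (A : Matrix m m ℂ) :
    (pinvH A).IsHermitian := by
  unfold pinvH
  split_ifs with hA
  · refine isHermitian_mul_mul_conjTranspose _ (isHermitian_diagonal_iff.mpr fun i => ?_)
    split_ifs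
    · exact .zero _
    · simp [IsSelfAdjoint]
  · exact isHermitian_zero

/-- The null projection of a Hermitian matrix is Hermitian; in the junk case it is `1`. -/
theorem isHermitian_nullProj {m : Type*} [Fintype m] [DecidableEq m] (A : Matrix m m ℂ) :
    (nullProj A).IsHermitian := by
  by_cases hA : A.IsHermitian
  · rw [IsHermitian, nullProj, conjTranspose_sub, conjTranspose_one, conjTranspose_mul,
      (isHermitian_pinvH A).eq, hA.eq, pinvH_mul_self_comm]
  · have hone : nullProj A = 1 := by simp [nullProj, pinvH, hA]
    rw [hone]
    exact isHermitian_one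

/-- The null projection fixes every vector of the null space. -/
theorem nullProj_mulVec_of_mulVec_eq_zero {m : Type*} [Fintype m] [DecidableEq m]
    {A : Matrix m m ℂ} {x : m → ℂ} (hx : A *ᵥ x = 0) : nullProj A *ᵥ x = x := by
  rw [nullProj, sub_mulVec, one_mulVec, ← mulVec_mulVec, hx, mulVec_zero, sub_zero]

/-- Lemma 3.7 of the paper: at a critical point with simple eigenvalue, the eigenvector
`f°` lies in `𝒬 = Null(BPB*)` and `S f° = 0` (so `0` is an eigenvalue of `S`), where `S`
is the compression `Q(T(α°) − λ(α°) − BΩ⁺B*)Q` of the shifted operator to `𝒬`. -/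
theorem eigenvector_in_Q_and_S_annihilates_it
    (d N : ℕ) (hd : 0 < d) (hN : 0 < N)
    (u v : Fin d → Fin N) (h : Fin d → ℂ) (hh : ∀ j, h j ≠ 0)
    (T0 : Matrix (Fin N) (Fin N) ℂ) (hT0 : T0.IsHermitian)
    (T : (Fin d → ℝ) → Matrix (Fin N) (Fin N) ℂ)
    (hT : ∀ α : Fin d → ℝ, T α = T0 + ∑ j : Fin d,
      (Matrix.single (u j) (v j) (h j * Complex.exp (Complex.I * (α j : ℂ))) +
       Matrix.single (v j) (u j)
         ((starRingEnd ℂ) (h j) * Complex.exp (-(Complex.I * (α j : ℂ))))))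
    (n : Fin N)
    (α0 : Fin d → ℝ) (f : Fin N → ℂ)
    (hsimple : Nat.card {i : Fin N // sortedEigs (T α0) i = sortedEigs (T α0) n} = 1)
    (hunit : star f ⬝ᵥ f = (1 : ℂ))
    (heig : (T α0).mulVec f = ((sortedEigs (T α0) n : ℝ) : ℂ) • f)
    (hcrit : ∀ j, (h j * Complex.exp (Complex.I * (α0 j : ℂ)) * f (v j) *
      (starRingEnd ℂ) (f (u j))).im = 0)
    (B : Matrix (Fin N) (Fin d) ℂ)
    (hB : B = Matrix.of fun i j => Complex.I *
      (h j * Complex.exp (Complex.I * (α0 j : ℂ)) * f (v j) * (if i = u j then 1 else 0) -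
       (starRingEnd ℂ) (h j) * Complex.exp (-(Complex.I * (α0 j : ℂ))) * f (u j) *
         (if i = v j then 1 else 0)))
    (Ω : Matrix (Fin d) (Fin d) ℂ)
    (hΩ : Ω = Matrix.diagonal fun j =>
      (((-(h j * Complex.exp (Complex.I * (α0 j : ℂ)) * f (v j) *
        (starRingEnd ℂ) (f (u j)))).re : ℝ) : ℂ))
    (P : Matrix (Fin d) (Fin d) ℂ) (hP : P = nullProj Ω)
    (Q : Matrix (Fin N) (Fin N) ℂ) (hQ : Q = nullProj (B * P * Bᴴ))
    (M : Matrix (Fin N) (Fin N) ℂ)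
    (hM : M = T α0 - ((sortedEigs (T α0) n : ℝ) : ℂ) • (1 : Matrix (Fin N) (Fin N) ℂ) -
      B * pinvH Ω * Bᴴ) :
    (B * P * Bᴴ).mulVec f = 0 ∧ (Q * M * Qᴴ).mulVec f = 0 := by
  have hBf : Bᴴ *ᵥ f = 0 := by
    ext j
    have hexp : (starRingEnd ℂ) (Complex.exp (-(Complex.I * (α0 j : ℂ)))) =
        Complex.exp (Complex.I * (α0 j : ℂ)) := by
      rw [← Complex.exp_conj]
      simp
    have hreal := Complex.conj_eq_iff_im.mpr (hcrit j)
    simp only [map_mul, Complex.conj_conj] at hreal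
    subst hB
    simp only [mulVec, dotProduct, conjTranspose_apply, of_apply, Complex.star_def, map_mul,
      map_sub, Complex.conj_I, Complex.conj_conj, hexp, apply_ite (starRingEnd ℂ),
      map_zero, mul_sub, sub_mul, Finset.sum_sub_distrib, mul_ite, ite_mul, mul_one, mul_zero,
      zero_mul, Finset.sum_ite_eq', Finset.mem_univ, if_true, Pi.zero_apply]
    linear_combination (-Complex.I) * hreal
  have hQf : (B * P * Bᴴ) *ᵥ f = 0 := by
    rw [← mulVec_mulVec, hBf, mulVec_zero]
  have hMf : M *ᵥ f = 0 := by
    rw [hM, sub_mulVec, sub_mulVec, heig, smul_mulVec, one_mulVec, sub_self, ← mulVec_mulVec, hBf,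
      mulVec_zero, sub_zero]
  refine ⟨hQf, ?_⟩
  rw [← mulVec_mulVec, hQ, (isHermitian_nullProj _).eq, nullProj_mulVec_of_mulVec_eq_zero hQf,
    ← mulVec_mulVec, hMf, mulVec_zero]
end
end

section
/- Assume the time-reversal symmetric case (T_0 real, all h_j real). Suppose α° ∈ {0, π}^d, λ(α°) is a simple eigenvalue of T(α°), its unit eigenvector f° is non-vanishing on crossing edges, and λ attains a local minimum (respectively local maximum) at α°. Then λ(α°) ≤ λ(α) (respectively λ(α) ≤ λ(α°)) for all α ∈ ℝ^d, i.e. the local extremum at the corner point α° is a global extremum. -/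
noncomputable section

open Matrix Complex
open scoped ComplexOrder

/-- The real quadratic form `y ↦ Re (y* M y)` of a complex matrix. -/
def quadForm {N : ℕ} (M : Matrix (Fin N) (Fin N) ℂ) (y : Fin N → ℂ) : ℝ :=
  (star y ⬝ᵥ M *ᵥ y).re

/-- `M` is negative definite on some subspace of dimension `k`. -/
def HasNegSubspace {N : ℕ} (M : Matrix (Fin N) (Fin N) ℂ) (k : ℕ) : Prop :=
  ∃ W : Submodule ℂ (Fin N → ℂ), Module.finrank ℂ W = k ∧ ∀ y ∈ W, y ≠ 0 → quadForm M y < 0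

lemma quadForm_smul {N : ℕ} (M : Matrix (Fin N) (Fin N) ℂ) (c : ℂ) (y : Fin N → ℂ) :
    quadForm M (c • y) = normSq c * quadForm M y := by
  have hc : star c * c = (normSq c : ℂ) := Complex.normSq_eq_conj_mul_self.symm
  rw [quadForm, quadForm, star_smul, mulVec_smul, smul_dotProduct, dotProduct_smul, smul_smul,
    hc, smul_eq_mul, re_ofReal_mul]

lemma star_dotProduct_mulVec_comm {N : ℕ} {M : Matrix (Fin N) (Fin N) ℂ} (hM : M.IsHermitian)
    (y z : Fin N → ℂ) : (star z ⬝ᵥ M *ᵥ y).re = (star y ⬝ᵥ M *ᵥ z).re := by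
  have h : star (star y ⬝ᵥ M *ᵥ z) = star z ⬝ᵥ M *ᵥ y := by
    rw [← star_dotProduct_star, star_star, star_mulVec, hM.eq, dotProduct_comm,
      dotProduct_mulVec, dotProduct_comm, dotProduct_comm]
  rw [← h]; simp

lemma quadForm_add {N : ℕ} {M : Matrix (Fin N) (Fin N) ℂ} (hM : M.IsHermitian)
    (y z : Fin N → ℂ) :
    quadForm M (y + z) = quadForm M y + 2 * (star y ⬝ᵥ M *ᵥ z).re + quadForm M z := by
  have h := star_dotProduct_mulVec_comm hM y z
  simp only [quadForm, star_add, mulVec_add, add_dotProduct, dotProduct_add, add_re, h]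
  ring

lemma quadForm_kernel_add {N : ℕ} {M : Matrix (Fin N) (Fin N) ℂ} (hM : M.IsHermitian)
    {g : Fin N → ℂ} (hg : M *ᵥ g = 0) (z : Fin N → ℂ) : quadForm M (g + z) = quadForm M z := by
  rw [quadForm_add hM, ← star_dotProduct_mulVec_comm hM, quadForm, hg]
  simp

lemma continuous_quadForm {N : ℕ} (M : Matrix (Fin N) (Fin N) ℂ) : Continuous (quadForm M) := by
  unfold quadForm
  fun_prop

lemma HasNegSubspace.of_injective {N k : ℕ} {M : Matrix (Fin N) (Fin N) ℂ} {E : Type*}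
    [AddCommGroup E] [Module ℂ E] [FiniteDimensional ℂ E] (hE : Module.finrank ℂ E = k)
    (Φ : E →ₗ[ℂ] Fin N → ℂ) (h : ∀ x, x ≠ 0 → quadForm M (Φ x) < 0) : HasNegSubspace M k := by
  have hinj : Function.Injective Φ := by
    rw [injective_iff_map_eq_zero]
    intro x hx
    by_contra hne
    have := h x hne
    rw [hx] at this
    simp [quadForm] at this
  refine ⟨LinearMap.range Φ, by rw [LinearMap.finrank_range_of_inj hinj, hE], ?_⟩
  rintro _ ⟨x, rfl⟩ hx
  exact h x fun h0 => hx (by rw [h0, map_zero])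

lemma quadForm_spectral {N : ℕ} {U : Matrix (Fin N) (Fin N) ℂ} (μ : Fin N → ℝ)
    (y : Fin N → ℂ) :
    quadForm (U * diagonal (fun i => (μ i : ℂ)) * Uᴴ) y = ∑ i, μ i * normSq ((Uᴴ *ᵥ y) i) := by
  have h : star y ⬝ᵥ (U * diagonal (fun i => (μ i : ℂ)) * Uᴴ) *ᵥ y =
      star (Uᴴ *ᵥ y) ⬝ᵥ diagonal (fun i => (μ i : ℂ)) *ᵥ (Uᴴ *ᵥ y) := by
    rw [star_mulVec, conjTranspose_conjTranspose, ← mulVec_mulVec, ← mulVec_mulVec,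
      dotProduct_mulVec]
  rw [quadForm, h, dotProduct, re_sum]
  refine Finset.sum_congr rfl fun i _ => ?_
  rw [mulVec_diagonal, Pi.star_apply, normSq_apply]
  simp
  ring

lemma hasNegSubspace_spectral_iff {N k : ℕ} {U : Matrix (Fin N) (Fin N) ℂ} (hU : Uᴴ * U = 1)
    (μ : Fin N → ℝ) :
    HasNegSubspace (U * diagonal (fun i => (μ i : ℂ)) * Uᴴ) k ↔
      k ≤ (Finset.univ.filter fun i => μ i < 0).card := by
  constructor
  · rintro ⟨W, hW, hneg⟩
    by_contra! hlt
    let Φ : W →ₗ[ℂ] ({i // μ i < 0} → ℂ) :=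
      (LinearMap.funLeft ℂ ℂ Subtype.val) ∘ₗ Uᴴ.mulVecLin ∘ₗ W.subtype
    have hker : LinearMap.ker Φ ≠ ⊥ := by
      apply LinearMap.ker_ne_bot_of_finrank_lt
      rw [Module.finrank_fintype_fun_eq_card, hW, Fintype.card_subtype]
      exact hlt
    obtain ⟨y, hy, hy0⟩ := Submodule.exists_mem_ne_zero_of_ne_bot hker
    have hq := hneg y y.2 (by simpa using hy0)
    rw [quadForm_spectral] at hq
    refine absurd hq (not_lt.2 (Finset.sum_nonneg fun i _ => ?_))
    by_cases hi : μ i < 0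
    · have : (Uᴴ *ᵥ (y : Fin N → ℂ)) i = 0 := congrFun (LinearMap.mem_ker.1 hy) ⟨i, hi⟩
      simp [this]
    · exact mul_nonneg (not_lt.1 hi) (normSq_nonneg _)
  · intro hk
    obtain ⟨S, hS, rfl⟩ := Finset.exists_subset_card_eq hk
    let Φ : (S → ℂ) →ₗ[ℂ] (Fin N → ℂ) :=
      U.mulVecLin ∘ₗ Function.ExtendByZero.linearMap ℂ (Subtype.val : S → Fin N)
    refine HasNegSubspace.of_injective (by simp) Φ fun x hx => ?_
    rw [quadForm_spectral]
    have hcoord : Uᴴ *ᵥ Φ x = Function.extend Subtype.val x 0 := by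
      simp only [Φ, LinearMap.comp_apply, mulVecLin_apply, mulVec_mulVec, hU, one_mulVec]
      rfl
    have hneg : ∀ i ∈ S, μ i < 0 := fun i hi => (Finset.mem_filter.1 (hS hi)).2
    rw [hcoord]
    obtain ⟨s, hs⟩ := Function.ne_iff.1 hx
    refine Finset.sum_neg' (fun i _ => ?_) ⟨s, Finset.mem_univ _, ?_⟩
    · by_cases hi : i ∈ S
      · exact mul_nonpos_of_nonpos_of_nonneg (hneg i hi).le (normSq_nonneg _)
      · rw [Function.extend_apply' _ _ _ (by simpa using hi)]
        simp
    · rw [Subtype.val_injective.extend_apply]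
      exact mul_neg_of_neg_of_pos (hneg s s.2) (normSq_pos.2 hs)

lemma exists_sorted_spectral {N : ℕ} {A : Matrix (Fin N) (Fin N) ℂ} (hA : A.IsHermitian) :
    Monotone (sortedEigs A) ∧ ∃ U : Matrix (Fin N) (Fin N) ℂ, Uᴴ * U = 1 ∧ U * Uᴴ = 1 ∧
      A = U * diagonal (fun i => (sortedEigs A i : ℂ)) * Uᴴ := by
  have hs : sortedEigs A = hA.eigenvalues ∘ Tuple.sort hA.eigenvalues := by
    rw [sortedEigs, dif_pos hA]
  refine ⟨hs ▸ Tuple.monotone_sort _, ?_⟩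
  set σ := Tuple.sort hA.eigenvalues
  set V : Matrix (Fin N) (Fin N) ℂ := hA.eigenvectorUnitary.1
  have h2 : V * Vᴴ = 1 := Unitary.coe_mul_star_self hA.eigenvectorUnitary
  have h3 : A = V * diagonal (fun i => (hA.eigenvalues i : ℂ)) * Vᴴ := by
    have h := hA.spectral_theorem
    rw [Unitary.conjStarAlgAut_apply] at h
    exact h
  have hd : diagonal (fun i => (sortedEigs A i : ℂ)) =
      (diagonal (fun i => (hA.eigenvalues i : ℂ))).submatrix σ σ := by
    rw [hs, submatrix_diagonal_equiv]; rfl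
  have hU : V.submatrix id σ * (V.submatrix id σ)ᴴ = 1 := by
    rw [conjTranspose_submatrix, submatrix_mul_equiv, h2]; simp
  refine ⟨V.submatrix id σ, mul_eq_one_comm.1 hU, hU, ?_⟩
  rw [hd, conjTranspose_submatrix, submatrix_mul_equiv, submatrix_mul_equiv, ← h3]; simp

lemma monotone_lt_iff_card {N : ℕ} {s : Fin N → ℝ} (hs : Monotone s) (n : Fin N) (c : ℝ) :
    s n < c ↔ (n : ℕ) + 1 ≤ (Finset.univ.filter fun i => s i < c).card := by
  constructor
  · intro h
    rw [← Fin.card_Iic]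
    exact Finset.card_le_card fun i hi => by
      simpa using (hs (Finset.mem_Iic.1 hi)).trans_lt h
  · intro h
    by_contra! hc
    have : (Finset.univ.filter fun i => s i < c).card ≤ n := by
      rw [← Fin.card_Iio]
      refine Finset.card_le_card fun i hi => ?_
      rw [Finset.mem_Iio]
      by_contra! hni
      exact absurd (Finset.mem_filter.1 hi).2 (not_lt.2 (hc.trans (hs hni)))
    omega

lemma lt_monotone_iff_card {N : ℕ} {s : Fin N → ℝ} (hs : Monotone s) (n : Fin N) (c : ℝ) :
    c < s n ↔ N - n ≤ (Finset.univ.filter fun i => c < s i).card := by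
  constructor
  · intro h
    rw [← Fin.card_Ici]
    exact Finset.card_le_card fun i hi => by
      simpa using h.trans_le (hs (Finset.mem_Ici.1 hi))
  · intro h
    by_contra! hc
    have : (Finset.univ.filter fun i => c < s i).card ≤ N - 1 - n := by
      rw [← Fin.card_Ioi]
      refine Finset.card_le_card fun i hi => ?_
      rw [Finset.mem_Ioi]
      by_contra! hni
      exact absurd (Finset.mem_filter.1 hi).2 (not_lt.2 ((hs hni).trans hc))
    omega

lemma smul_sub_spectral {N : ℕ} {U : Matrix (Fin N) (Fin N) ℂ} (hU : U * Uᴴ = 1)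
    (μ : Fin N → ℝ) (r c : ℝ) :
    (r : ℂ) • (U * diagonal (fun i => (μ i : ℂ)) * Uᴴ - (c : ℂ) • 1) =
      U * diagonal (fun i => ((r * (μ i - c) : ℝ) : ℂ)) * Uᴴ := by
  have h : diagonal (fun i => ((r * (μ i - c) : ℝ) : ℂ)) =
      (r : ℂ) • (diagonal (fun i => (μ i : ℂ)) - (c : ℂ) • (1 : Matrix (Fin N) (Fin N) ℂ)) := by
    ext i j
    by_cases hij : i = j
    · subst hij; simp
    · simp [hij]
  rw [h, Matrix.mul_smul, Matrix.smul_mul, Matrix.mul_sub, Matrix.sub_mul, Matrix.mul_smul,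
    Matrix.smul_mul, Matrix.mul_one, hU]

lemma sortedEigs_lt_iff {N : ℕ} {A : Matrix (Fin N) (Fin N) ℂ} (hA : A.IsHermitian) (n : Fin N)
    (c : ℝ) :
    sortedEigs A n < c ↔ HasNegSubspace (((1 : ℝ) : ℂ) • (A - (c : ℂ) • 1)) (n + 1) := by
  obtain ⟨hs, U, h1, h2, h3⟩ := exists_sorted_spectral hA
  rw [monotone_lt_iff_card hs]
  conv_rhs => rw [h3, smul_sub_spectral h2, hasNegSubspace_spectral_iff h1]
  simp

lemma lt_sortedEigs_iff {N : ℕ} {A : Matrix (Fin N) (Fin N) ℂ} (hA : A.IsHermitian) (n : Fin N)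
    (c : ℝ) :
    c < sortedEigs A n ↔ HasNegSubspace (((-1 : ℝ) : ℂ) • (A - (c : ℂ) • 1)) (N - n) := by
  obtain ⟨hs, U, h1, h2, h3⟩ := exists_sorted_spectral hA
  rw [lt_monotone_iff_card hs]
  conv_rhs => rw [h3, smul_sub_spectral h2, hasNegSubspace_spectral_iff h1]
  simp

lemma quadForm_map_ofReal {N : ℕ} (B : Matrix (Fin N) (Fin N) ℝ) (y : Fin N → ℂ) :
    quadForm (B.map ofReal) y =
      (fun i => (y i).re) ⬝ᵥ B *ᵥ (fun i => (y i).re) +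
        (fun i => (y i).im) ⬝ᵥ B *ᵥ (fun i => (y i).im) := by
  simp only [quadForm, dotProduct, mulVec, map_apply, Pi.star_apply, re_sum, im_sum, mul_re,
    mul_im, RCLike.star_def, conj_re, conj_im, ofReal_re, ofReal_im, zero_mul, sub_zero, add_zero,
    ← Finset.sum_add_distrib, neg_mul, sub_neg_eq_add]

/-- The Hermitian matrix `B` with the hopping along each edge `(u j, v j)`, of amplitude `h j`,
twisted by the phase `β j`. -/
def twisted {d N : ℕ} (B : Matrix (Fin N) (Fin N) ℂ) (u v : Fin d → Fin N) (h β : Fin d → ℝ) :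
    Matrix (Fin N) (Fin N) ℂ :=
  B + ∑ j, (Matrix.single (u j) (v j) ((h j : ℂ) * (exp (I * β j) - 1)) +
    Matrix.single (v j) (u j) ((h j : ℂ) * (exp (-(I * β j)) - 1)))

/-- The quadratic form of the Schur complement `D - Y* B Y`, where
`D = diag (- h j * g (u j) * g (v j))`; it is half the Hessian of the band function. -/
def schurForm {d N : ℕ} (B : Matrix (Fin N) (Fin N) ℂ) (u v : Fin d → Fin N) (h : Fin d → ℝ)
    (g : Fin N → ℝ) (Y : Matrix (Fin N) (Fin d) ℂ) (x : Fin d → ℂ) : ℝ :=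
  ∑ j, -(h j * g (u j) * g (v j)) * normSq (x j) - quadForm B (Y *ᵥ x)

lemma schurForm_smul {d N : ℕ} (B : Matrix (Fin N) (Fin N) ℂ) (u v : Fin d → Fin N)
    (h : Fin d → ℝ) (g : Fin N → ℝ) (Y : Matrix (Fin N) (Fin d) ℂ) (c : ℂ) (x : Fin d → ℂ) :
    schurForm B u v h g Y (c • x) = normSq c * schurForm B u v h g Y x := by
  simp only [schurForm, mulVec_smul, quadForm_smul, Pi.smul_apply, smul_eq_mul, map_mul, mul_sub,
    Finset.mul_sum]
  congr 1
  exact Finset.sum_congr rfl fun j _ => by ring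

lemma continuous_schurForm {d N : ℕ} (B : Matrix (Fin N) (Fin N) ℂ) (u v : Fin d → Fin N)
    (h : Fin d → ℝ) (g : Fin N → ℝ) (Y : Matrix (Fin N) (Fin d) ℂ) :
    Continuous (schurForm B u v h g Y) := by
  have h1 := continuous_quadForm B
  unfold schurForm
  have h2 : Continuous fun x : Fin d → ℂ => quadForm B (Y *ᵥ x) := h1.comp (by fun_prop)
  have h3 := Complex.continuous_normSq
  refine Continuous.sub (continuous_finsetSum _ fun j _ => ?_) h2
  exact continuous_const.mul (h3.comp (continuous_apply j))

lemma schurForm_eq_re_add_im {d N : ℕ} (B : Matrix (Fin N) (Fin N) ℝ) (u v : Fin d → Fin N)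
    (h : Fin d → ℝ) (g : Fin N → ℝ) (Y : Matrix (Fin N) (Fin d) ℝ) (x : Fin d → ℂ) :
    schurForm (B.map ofReal) u v h g (Y.map ofReal) x =
      schurForm (B.map ofReal) u v h g (Y.map ofReal) (fun j => ((x j).re : ℂ)) +
        schurForm (B.map ofReal) u v h g (Y.map ofReal) (fun j => ((x j).im : ℂ)) := by
  have hre (z : Fin d → ℂ) :
      (fun i => ((Y.map ofReal *ᵥ z) i).re) = Y *ᵥ fun j => (z j).re := by
    ext i; simp [mulVec, dotProduct, re_sum]
  have him (z : Fin d → ℂ) :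
      (fun i => ((Y.map ofReal *ᵥ z) i).im) = Y *ᵥ fun j => (z j).im := by
    ext i; simp [mulVec, dotProduct, im_sum]
  have h0 : Y *ᵥ (fun _ => (0 : ℝ)) = 0 := mulVec_zero Y
  have hD : ∑ j, -(h j * g (u j) * g (v j)) * normSq (x j) =
      ∑ j, -(h j * g (u j) * g (v j)) * normSq ((x j).re : ℂ) +
        ∑ j, -(h j * g (u j) * g (v j)) * normSq ((x j).im : ℂ) := by
    rw [← Finset.sum_add_distrib]
    refine Finset.sum_congr rfl fun j _ => ?_
    rw [normSq_apply, normSq_ofReal, normSq_ofReal]; ring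
  simp only [schurForm, quadForm_map_ofReal, hre, him, hD, ofReal_re, ofReal_im, h0,
    zero_dotProduct]
  ring

lemma quadForm_twisted {d N : ℕ} (B : Matrix (Fin N) (Fin N) ℂ) (u v : Fin d → Fin N)
    (h β : Fin d → ℝ) (y : Fin N → ℂ) :
    quadForm (twisted B u v h β) y =
      quadForm B y + ∑ j, 2 * h j * ((exp (I * β j) - 1) * star (y (u j)) * y (v j)).re := by
  have hs (i k : Fin N) (c : ℂ) : star y ⬝ᵥ Matrix.single i k c *ᵥ y = c * star (y i) * y k := by
    rw [single_mulVec, ← Pi.single, dotProduct_single, Pi.star_apply]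
    ring
  have hconj (j : Fin d) : exp (-(I * β j)) = star (exp (I * β j)) := by
    rw [RCLike.star_def, ← exp_conj]; simp
  rw [quadForm, twisted, add_mulVec, sum_mulVec, dotProduct_add, add_re, dotProduct_sum, re_sum]
  congr 1
  refine Finset.sum_congr rfl fun j _ => ?_
  rw [add_mulVec, dotProduct_add, hs, hs, hconj]
  simp
  ring

/-- Completing the square: the twisted form is the sum of a pullback of `B` and of the Schur
complement form. -/
lemma quadForm_twisted_eq {d N : ℕ} {B : Matrix (Fin N) (Fin N) ℂ} (hB : B.IsHermitian)
    (u v : Fin d → Fin N) (h β : Fin d → ℝ) (g : Fin N → ℝ) (hg : ∀ j, g (v j) ≠ 0)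
    (Y : Matrix (Fin N) (Fin d) ℂ)
    (hY : B * Y = of fun i j => (h j : ℂ) *
      (g (v j) * (if i = u j then 1 else 0) - g (u j) * (if i = v j then 1 else 0)))
    (y : Fin N → ℂ) (x : Fin d → ℂ)
    (hx : ∀ j, (g (v j) : ℂ) * x j = (exp (I * β j) - 1) * y (v j)) :
    quadForm (twisted B u v h β) y = quadForm B (y + Y *ᵥ x) + schurForm B u v h g Y x := by
  have hcross : star y ⬝ᵥ B *ᵥ (Y *ᵥ x) =
      ∑ j, (h j : ℂ) * (g (v j) * star (y (u j)) - g (u j) * star (y (v j))) * x j := by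
    rw [mulVec_mulVec, hY, dotProduct_mulVec]
    refine Finset.sum_congr rfl fun j _ => ?_
    congr 1
    simp only [vecMul, dotProduct, of_apply, Pi.star_apply, mul_sub, Finset.sum_sub_distrib,
      mul_ite, mul_one, mul_zero, Finset.sum_ite_eq', Finset.mem_univ, if_true]
    ring
  rw [quadForm_twisted, quadForm_add hB, schurForm, hcross, re_sum, Finset.mul_sum]
  have key : ∀ j, 2 * h j * ((exp (I * β j) - 1) * star (y (u j)) * y (v j)).re =
      2 * ((h j : ℂ) * (g (v j) * star (y (u j)) - g (u j) * star (y (v j))) * x j).re +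
        -(h j * g (u j) * g (v j)) * normSq (x j) := by
    intro j
    have hxj : x j = (exp (I * β j) - 1) * y (v j) / g (v j) := by
      rw [← hx, mul_div_cancel_left₀]
      exact_mod_cast hg j
    have hw : 2 * (exp (I * β j) - 1).re + normSq (exp (I * β j) - 1) = 0 := by
      have h1 := Real.sin_sq_add_cos_sq (β j)
      rw [mul_comm I, exp_mul_I, ← ofReal_cos, ← ofReal_sin, normSq_apply]
      simp only [sub_re, add_re, mul_re, I_re, I_im, ofReal_re, ofReal_im, one_re, sub_im, add_im,
        mul_im, one_im]
      nlinarith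
    generalize exp (I * β j) - 1 = w at hxj hw
    have e1 : (h j : ℂ) * (g (v j) * star (y (u j)) - g (u j) * star (y (v j))) * x j =
        (h j : ℂ) * (w * star (y (u j)) * y (v j)) -
          ((h j * g (u j) / g (v j) * normSq (y (v j)) : ℝ) : ℂ) * w := by
      have hg' : (g (v j) : ℂ) ≠ 0 := by exact_mod_cast hg j
      push_cast
      rw [hxj, Complex.normSq_eq_conj_mul_self, ← RCLike.star_def]
      field_simp
    have e2 : normSq (x j) = normSq w * normSq (y (v j)) / (g (v j)) ^ 2 := by
      rw [hxj, normSq_div, normSq_mul, normSq_ofReal, sq]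
    rw [e1, sub_re, re_ofReal_mul, re_ofReal_mul, e2]
    have hgj := hg j
    field_simp
    linear_combination (h j * g (u j) * normSq (y (v j))) * hw
  simp only [key, Finset.sum_add_distrib]
  ring

/-- A local index bound forces the Schur complement form to be nonnegative. -/
lemma schurForm_nonneg_of_eventually {d N k : ℕ} {B : Matrix (Fin N) (Fin N) ℂ}
    (hB : B.IsHermitian) (u v : Fin d → Fin N) (h : Fin d → ℝ) (g : Fin N → ℝ)
    (hg : ∀ j, g (v j) ≠ 0) (hBg : B *ᵥ (fun i => (g i : ℂ)) = 0)
    (Y : Matrix (Fin N) (Fin d) ℂ)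
    (hY : B * Y = of fun i j => (h j : ℂ) *
      (g (v j) * (if i = u j then 1 else 0) - g (u j) * (if i = v j then 1 else 0)))
    (hk : HasNegSubspace B k)
    (hloc : ∀ᶠ β in nhds (0 : Fin d → ℝ), ¬ HasNegSubspace (twisted B u v h β) (k + 1))
    (t : Fin d → ℝ) : 0 ≤ schurForm B u v h g Y (fun j => (t j : ℂ)) := by
  by_contra! hneg
  obtain ⟨V, hV, hVneg⟩ := hk
  set tc : Fin d → ℂ := fun j => (t j : ℂ) with htc
  set gc : Fin N → ℂ := fun i => (g i : ℂ) with hgc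
  let w : Fin d → ℝ → ℂ := fun j => dslope (fun ε : ℝ => exp (I * (ε * t j : ℝ))) 0
  have hder (j : Fin d) : HasDerivAt (fun ε : ℝ => exp (I * (ε * t j : ℝ))) (I * t j) 0 := by
    have h1 : HasDerivAt (fun ε : ℝ => ε * t j) (t j) 0 := by
      simpa using (hasDerivAt_id (0 : ℝ)).mul_const (t j)
    simpa using (h1.ofReal_comp.const_mul I).cexp
  have hw0 (j : Fin d) : w j 0 = I * t j := by
    simp only [w, dslope_same]; exact (hder j).deriv
  have hwc (j : Fin d) : ContinuousAt (w j) 0 :=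
    continuousAt_dslope_same.2 (hder j).differentiableAt
  have hw (j : Fin d) (ε : ℝ) : (ε : ℂ) * w j ε = exp (I * (ε * t j : ℝ)) - 1 := by
    have := sub_smul_dslope (fun ε : ℝ => exp (I * (ε * t j : ℝ))) 0 ε
    simpa [w] using this
  -- the rescaled Schur component of the trial vector
  let x' : ℝ → V × ℂ → Fin d → ℂ := fun ε η j =>
    (exp (I * (ε * t j : ℝ)) - 1) / g (v j) *
      ((η.1 : Fin N → ℂ) (v j) - I * η.2 * (Y *ᵥ tc) (v j)) + η.2 * w j ε
  let F : ℝ → V × ℂ → ℝ := fun ε η =>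
    quadForm B ((η.1 : Fin N → ℂ) - (I * η.2) • Y *ᵥ tc + Y *ᵥ x' ε η) +
      schurForm B u v h g Y (x' ε η)
  have hx'0 (η : V × ℂ) : x' 0 η = (I * η.2) • tc := by
    ext j
    simp [x', hw0, tc]
    ring
  have hF0 (η : V × ℂ) (hη : η ≠ 0) : F 0 η < 0 := by
    have e : F 0 η = quadForm B (η.1 : Fin N → ℂ) +
        normSq η.2 * schurForm B u v h g Y tc := by
      simp only [F, hx'0, mulVec_smul, sub_add_cancel, schurForm_smul, map_mul, normSq_I, one_mul]
    rw [e]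
    by_cases h1 : η.1 = 0
    · have h2 : η.2 ≠ 0 := fun h2 => hη (Prod.ext h1 h2)
      have := mul_neg_of_pos_of_neg (normSq_pos.2 h2) hneg
      simpa [h1, quadForm] using this
    · have h1' := hVneg η.1 η.1.2 (by simpa using h1)
      have := mul_nonpos_of_nonneg_of_nonpos (normSq_nonneg η.2) hneg.le
      linarith
  have hFc (η : V × ℂ) : ContinuousAt (fun p : ℝ × (V × ℂ) => F p.1 p.2) (0, η) := by
    have hxc : ContinuousAt (fun p : ℝ × (V × ℂ) => x' p.1 p.2) (0, η) := by
      refine continuousAt_pi.2 fun j => ?_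
      have h1 : ContinuousAt (fun p : ℝ × (V × ℂ) => w j p.1) (0, η) :=
        ContinuousAt.comp (f := Prod.fst) (hwc j) continuousAt_fst
      have hval : Continuous fun p : ℝ × (V × ℂ) => (p.2.1 : Fin N → ℂ) (v j) :=
        (continuous_apply (v j)).comp (continuous_subtype_val.comp (by fun_prop))
      have h2 : Continuous fun p : ℝ × (V × ℂ) => (exp (I * (p.1 * t j : ℝ)) - 1) / g (v j) *
          ((p.2.1 : Fin N → ℂ) (v j) - I * p.2.2 * (Y *ᵥ tc) (v j)) := by fun_prop
      exact h2.continuousAt.add (ContinuousAt.mul (by fun_prop) h1)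
    refine ContinuousAt.add ?_ ((continuous_schurForm B u v h g Y).continuousAt.comp hxc)
    refine (continuous_quadForm B).continuousAt.comp ?_
    refine ContinuousAt.add (by fun_prop) ?_
    exact ContinuousAt.comp (g := fun x => Y *ᵥ x) (by fun_prop) hxc
  have : ProperSpace V := FiniteDimensional.proper ℂ V
  have hev : ∀ᶠ ε in nhds (0 : ℝ), ∀ η ∈ Metric.sphere (0 : V × ℂ) 1, F ε η < 0 := by
    refine (isCompact_sphere _ _).eventually_forall_of_forall_eventually fun η hη => ?_
    exact (hFc η).eventually_lt_const (hF0 η (ne_zero_of_mem_unit_sphere ⟨η, hη⟩))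
  have hloc' : ∀ᶠ ε in nhds (0 : ℝ), ¬ HasNegSubspace (twisted B u v h (ε • t)) (k + 1) := by
    have hc : Continuous fun ε : ℝ => ε • t := by fun_prop
    exact (hc.tendsto' 0 0 (by simp)).eventually hloc
  obtain ⟨ε, ⟨h1, h2⟩, hε⟩ :=
    ((hev.and hloc').filter_mono nhdsWithin_le_nhds |>.and
      (self_mem_nhdsWithin : Set.Ioi (0 : ℝ) ∈ nhdsWithin 0 (Set.Ioi 0))).exists
  replace hε : 0 < ε := hε
  refine h2 ?_
  let Φ : V × ℂ →ₗ[ℂ] Fin N → ℂ := ((ε : ℂ) • V.subtype).coprod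
    (LinearMap.toSpanSingleton ℂ _ (gc - (I * ε) • Y *ᵥ tc))
  have hΦ (η : V × ℂ) : Φ η = (ε : ℂ) • (η.1 : Fin N → ℂ) + η.2 • (gc - (I * ε) • Y *ᵥ tc) := by
    simp [Φ]
  have hq (η : V × ℂ) : quadForm (twisted B u v h (ε • t)) (Φ η) = ε ^ 2 * F ε η := by
    rw [quadForm_twisted_eq hB u v h (ε • t) g hg Y hY (Φ η) ((ε : ℂ) • x' ε η)]
    · have e : Φ η + Y *ᵥ ((ε : ℂ) • x' ε η) = η.2 • gc +
          (ε : ℂ) • ((η.1 : Fin N → ℂ) - (I * η.2) • Y *ᵥ tc + Y *ᵥ x' ε η) := by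
        rw [hΦ, mulVec_smul]; module
      rw [e, quadForm_kernel_add hB (by rw [mulVec_smul, hBg, smul_zero]), quadForm_smul,
        schurForm_smul, normSq_ofReal]
      simp only [F]; ring
    · intro j
      have hg' : (g (v j) : ℂ) ≠ 0 := by exact_mod_cast hg j
      have hwj := hw j ε
      rw [hΦ]
      simp only [Pi.smul_apply, Pi.add_apply, Pi.sub_apply, smul_eq_mul, x', gc]
      rw [← hwj]
      field_simp
      ring
  refine HasNegSubspace.of_injective (E := V × ℂ) (by simp [hV]) Φ fun η hη => ?_
  have hn : ‖η‖ ≠ 0 := norm_ne_zero_iff.2 hη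
  have hs := h1 (((‖η‖ : ℂ)⁻¹) • η) (by simp [norm_smul, hn])
  have hs2 : quadForm (twisted B u v h (ε • t)) (Φ (((‖η‖ : ℂ)⁻¹) • η)) < 0 := by
    rw [hq]; exact mul_neg_of_pos_of_neg (by positivity) hs
  rw [map_smul, quadForm_smul] at hs2
  exact (neg_of_mul_neg_right hs2 (normSq_nonneg _))

/-- If the index bound holds at `0` and near `0`, it holds for all phases. -/
lemma not_hasNegSubspace_twisted {d N k : ℕ} {B : Matrix (Fin N) (Fin N) ℝ}
    (hB : (B.map ofReal).IsHermitian) (u v : Fin d → Fin N) (h : Fin d → ℝ) (g : Fin N → ℝ)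
    (hg : ∀ j, g (v j) ≠ 0) (hBg : B.map ofReal *ᵥ (fun i => (g i : ℂ)) = 0)
    (Y : Matrix (Fin N) (Fin d) ℝ)
    (hY : B.map ofReal * Y.map ofReal = of fun i j => (h j : ℂ) *
      (g (v j) * (if i = u j then 1 else 0) - g (u j) * (if i = v j then 1 else 0)))
    (hk : HasNegSubspace (B.map ofReal) k) (hk' : ¬ HasNegSubspace (B.map ofReal) (k + 1))
    (hloc : ∀ᶠ β in nhds (0 : Fin d → ℝ),
      ¬ HasNegSubspace (twisted (B.map ofReal) u v h β) (k + 1))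
    (β : Fin d → ℝ) : ¬ HasNegSubspace (twisted (B.map ofReal) u v h β) (k + 1) := by
  rintro ⟨W, hW, hneg⟩
  have hreal := schurForm_nonneg_of_eventually hB u v h g hg hBg _ hY hk hloc
  let X : (Fin N → ℂ) →ₗ[ℂ] Fin d → ℂ :=
    LinearMap.pi fun j => ((exp (I * β j) - 1) / g (v j)) • LinearMap.proj (v j)
  let L : W →ₗ[ℂ] Fin N → ℂ := (LinearMap.id + (Y.map ofReal).mulVecLin ∘ₗ X) ∘ₗ W.subtype
  refine hk' (HasNegSubspace.of_injective hW L fun y hy => ?_)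
  have hq := hneg y y.2 (by simpa using hy)
  rw [quadForm_twisted_eq hB u v h β g hg _ hY y (X y), schurForm_eq_re_add_im] at hq
  · have h1 := hreal fun j => (X y j).re
    have h2 := hreal fun j => (X y j).im
    have h3 : L y = y + Y.map ofReal *ᵥ X y := by simp [L]
    rw [h3]
    linarith
  · intro j
    have hg' : (g (v j) : ℂ) ≠ 0 := by exact_mod_cast hg j
    simp [X]
    field_simp

/-- A real Hermitian matrix with one-dimensional kernel: the kernel has a real generator with the
support of any given nonzero kernel vector, and real vectors orthogonal to it have real
preimages. -/
lemma exists_real_kernel {N : ℕ} {B : Matrix (Fin N) (Fin N) ℝ} {U : Matrix (Fin N) (Fin N) ℂ}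
    (hU : Uᴴ * U = 1) (hU' : U * Uᴴ = 1) {μ : Fin N → ℝ}
    (hB : B.map ofReal = U * diagonal (fun i => (μ i : ℂ)) * Uᴴ) {n : Fin N}
    (hμ : ∀ i, i ≠ n → μ i ≠ 0) {f : Fin N → ℂ} (hf : f ≠ 0) (hBf : B.map ofReal *ᵥ f = 0) :
    ∃ g : Fin N → ℝ, B.map ofReal *ᵥ (fun i => (g i : ℂ)) = 0 ∧ (∀ i, f i ≠ 0 → g i ≠ 0) ∧
      ∀ a : Fin N → ℝ, g ⬝ᵥ a = 0 → ∃ y : Fin N → ℝ, B *ᵥ y = a := by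
  set e : Fin N → ℂ := fun i => U i n
  have hker (z : Fin N → ℂ) (hz : B.map ofReal *ᵥ z = 0) : z = (Uᴴ *ᵥ z) n • e := by
    have h1 : diagonal (fun i => (μ i : ℂ)) *ᵥ (Uᴴ *ᵥ z) = 0 := by
      have : Uᴴ *ᵥ (B.map ofReal *ᵥ z) = 0 := by rw [hz, mulVec_zero]
      rwa [hB, mulVec_mulVec, ← Matrix.mul_assoc, ← Matrix.mul_assoc, hU, Matrix.one_mul,
        ← mulVec_mulVec] at this
    have h2 (i : Fin N) (hi : i ≠ n) : (Uᴴ *ᵥ z) i = 0 := by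
      have := congrFun h1 i
      rw [mulVec_diagonal, Pi.zero_apply, mul_eq_zero] at this
      exact this.resolve_left (by exact_mod_cast hμ i hi)
    have h3 : z = U *ᵥ (Uᴴ *ᵥ z) := by rw [mulVec_mulVec, hU', one_mulVec]
    conv_lhs => rw [h3]
    ext i
    rw [mulVec, dotProduct, Finset.sum_eq_single n (fun j _ hj => by rw [h2 j hj, mul_zero])
      (by simp)]
    simp [e, mul_comm]
  have hre (z : Fin N → ℂ) (i : Fin N) :
      ((B.map ofReal *ᵥ z) i).re = (B *ᵥ fun i => (z i).re) i := by
    simp [mulVec, dotProduct, re_sum]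
  have him (z : Fin N → ℂ) (i : Fin N) :
      ((B.map ofReal *ᵥ z) i).im = (B *ᵥ fun i => (z i).im) i := by
    simp [mulVec, dotProduct, im_sum]
  have hcast (g : Fin N → ℝ) (hg : B *ᵥ g = 0) :
      B.map ofReal *ᵥ (fun i => (g i : ℂ)) = 0 := by
    ext i
    apply Complex.ext
    · rw [hre]; simp [hg]
    · rw [him]
      have : (fun i => ((g i : ℂ)).im) = (0 : Fin N → ℝ) := by ext; simp
      rw [this, mulVec_zero]; simp
  obtain ⟨g, hg0, hg⟩ : ∃ g : Fin N → ℝ, g ≠ 0 ∧ B *ᵥ g = 0 := by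
    by_cases h : (fun i => (f i).re) = 0
    · refine ⟨fun i => (f i).im, fun h' => hf ?_, ?_⟩
      · ext i; exact Complex.ext (congrFun h i) (congrFun h' i)
      · ext i; rw [← him, hBf]; simp
    · exact ⟨_, h, by ext i; rw [← hre, hBf]; simp⟩
  have hge := hker _ (hcast g hg)
  set c := (Uᴴ *ᵥ fun i => (g i : ℂ)) n
  have hc : c ≠ 0 := by
    intro hc
    rw [hc, zero_smul] at hge
    exact hg0 (funext fun i => by simpa using congrFun hge i)
  refine ⟨g, hcast g hg, fun i hi hgi => hi ?_, fun a ha => ?_⟩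
  · have h1 := congrFun hge i
    simp only [hgi, ofReal_zero, Pi.smul_apply, smul_eq_mul, zero_eq_mul, hc, false_or] at h1
    rw [hker f hBf, Pi.smul_apply, h1, smul_zero]
  · set ac : Fin N → ℂ := fun i => (a i : ℂ)
    have hn : (Uᴴ *ᵥ ac) n = 0 := by
      have h1 : star c * (Uᴴ *ᵥ ac) n = 0 := by
        have h2 : star (fun i => (g i : ℂ)) ⬝ᵥ ac = star c * (Uᴴ *ᵥ ac) n := by
          rw [hge, star_smul, smul_dotProduct]; rfl
        rw [← h2]
        have h3 : star (fun i => (g i : ℂ)) ⬝ᵥ ac = ((g ⬝ᵥ a : ℝ) : ℂ) := by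
          simp [dotProduct, ac]
        rw [h3, ha, ofReal_zero]
      exact (mul_eq_zero.1 h1).resolve_left (star_ne_zero.2 hc)
    let z : Fin N → ℂ := fun i => (Uᴴ *ᵥ ac) i / μ i
    have hz : B.map ofReal *ᵥ (U *ᵥ z) = ac := by
      have h1 : diagonal (fun i => (μ i : ℂ)) *ᵥ z = Uᴴ *ᵥ ac := by
        ext i
        rw [mulVec_diagonal]
        by_cases hi : i = n
        · subst hi; simp [z, hn]
        · have : (μ i : ℂ) ≠ 0 := by exact_mod_cast hμ i hi
          simp only [z]; field_simp
      rw [hB, mulVec_mulVec, Matrix.mul_assoc, hU, Matrix.mul_one, ← mulVec_mulVec, h1,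
        mulVec_mulVec, hU', one_mulVec]
    refine ⟨fun i => ((U *ᵥ z) i).re, ?_⟩
    ext i
    rw [← hre, hz]; simp [ac]

/-- The index bound for `r • (T α - c)`, where `c` is an eigenvalue of the corner matrix `T α0`
with one-dimensional eigenspace spanned by `f`. -/
lemma not_hasNegSubspace_of_corner {d N k : ℕ} (u v : Fin d → Fin N) (h : Fin d → ℂ)
    (T0 : Matrix (Fin N) (Fin N) ℂ) (T : (Fin d → ℝ) → Matrix (Fin N) (Fin N) ℂ)
    (hT : ∀ α : Fin d → ℝ, T α = T0 + ∑ j : Fin d,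
      (Matrix.single (u j) (v j) (h j * exp (I * (α j : ℂ))) +
       Matrix.single (v j) (u j) ((starRingEnd ℂ) (h j) * exp (-(I * (α j : ℂ))))))
    (hT0real : ∀ i j, (T0 i j).im = 0) (hhreal : ∀ j, (h j).im = 0)
    (α0 : Fin d → ℝ) (hTα0 : (T α0).IsHermitian)
    (hcorner : ∀ j : Fin d, α0 j = 0 ∨ α0 j = Real.pi) (n : Fin N)
    (hsimple : ∀ i, sortedEigs (T α0) i = sortedEigs (T α0) n → i = n)
    (f : Fin N → ℂ) (hf : f ≠ 0)
    (heig : (T α0).mulVec f = ((sortedEigs (T α0) n : ℝ) : ℂ) • f)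
    (hnv : ∀ j, f (u j) ≠ 0 ∨ f (v j) ≠ 0) (r : ℝ) (hr : r ≠ 0)
    (hk : HasNegSubspace ((r : ℂ) • (T α0 - (sortedEigs (T α0) n : ℂ) • 1)) k)
    (hk' : ¬ HasNegSubspace ((r : ℂ) • (T α0 - (sortedEigs (T α0) n : ℂ) • 1)) (k + 1))
    (hloc : ∀ᶠ α in nhds α0,
      ¬ HasNegSubspace ((r : ℂ) • (T α - (sortedEigs (T α0) n : ℂ) • 1)) (k + 1))
    (α : Fin d → ℝ) :
    ¬ HasNegSubspace ((r : ℂ) • (T α - (sortedEigs (T α0) n : ℂ) • 1)) (k + 1) := by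
  obtain ⟨-, U, hU, hU', hspec⟩ := exists_sorted_spectral hTα0
  set c := sortedEigs (T α0) n with hc
  set M := (r : ℂ) • (T α0 - (c : ℂ) • (1 : Matrix (Fin N) (Fin N) ℂ)) with hM
  have hMspec : M = U * diagonal (fun i => ((r * (sortedEigs (T α0) i - c) : ℝ) : ℂ)) * Uᴴ := by
    rw [← smul_sub_spectral hU', ← hspec]
  -- the hopping amplitudes at the corner are real
  let a : Fin d → ℝ := fun j => (h j).re * Real.cos (α0 j)
  have hsin (j : Fin d) : Real.sin (α0 j) = 0 := by
    rcases hcorner j with h0 | h0 <;> simp [h0]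
  have hh (j : Fin d) : h j = ((h j).re : ℂ) := Complex.ext rfl (by simp [hhreal j])
  have hexp (j : Fin d) : exp (I * (α0 j : ℂ)) = (Real.cos (α0 j) : ℂ) := by
    rw [mul_comm, exp_mul_I, ← ofReal_cos, ← ofReal_sin, hsin]; simp
  have hexp' (j : Fin d) : exp (-(I * (α0 j : ℂ))) = (Real.cos (α0 j) : ℂ) := by
    rw [exp_neg, hexp, ← ofReal_inv]
    congr 1
    rcases hcorner j with h0 | h0 <;> norm_num [h0]
  have ha (j : Fin d) : h j * exp (I * (α0 j : ℂ)) = (a j : ℂ) := by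
    rw [hexp, hh]; simp [a]
  have ha' (j : Fin d) : (starRingEnd ℂ) (h j) * exp (-(I * (α0 j : ℂ))) = (a j : ℂ) := by
    rw [hexp', hh, conj_ofReal]; simp [a]
  have hMreal : (M.map re).map ofReal = M := by
    have h0 (i k : Fin N) : (T α0 i k).im = 0 := by
      rw [hT]
      simp only [ha, ha', Matrix.add_apply, Matrix.sum_apply, add_im, im_sum, hT0real, zero_add]
      refine Finset.sum_eq_zero fun j _ => ?_
      simp only [Matrix.single_apply]
      split_ifs <;> simp
    ext i k
    apply Complex.ext
    · simp
    · by_cases hik : i = k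
      · subst hik; simp [M, h0]
      · simp [M, h0, hik]
  have hMherm : M.IsHermitian := by
    rw [hMspec, IsHermitian, conjTranspose_mul, conjTranspose_mul, conjTranspose_conjTranspose,
      diagonal_conjTranspose, Matrix.mul_assoc]
    congr 3
    ext i; simp
  have hMf : M *ᵥ f = 0 := by
    rw [hM, smul_mulVec, sub_mulVec, heig, smul_mulVec, one_mulVec, sub_self, smul_zero]
  obtain ⟨g, hg, hgf, hsolve⟩ := exists_real_kernel (B := M.map re) hU hU'
    (hMreal.trans hMspec) (n := n)
    (fun i hi => mul_ne_zero hr (sub_ne_zero.2 fun h0 => hi (hsimple i h0))) hf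
    (by rw [hMreal]; exact hMf)
  -- orient each edge so that its head lies in the support of `g`
  let u' : Fin d → Fin N := fun j => if g (v j) ≠ 0 then u j else v j
  let v' : Fin d → Fin N := fun j => if g (v j) ≠ 0 then v j else u j
  let σ : Fin d → ℝ := fun j => if g (v j) ≠ 0 then 1 else -1
  have hg' (j : Fin d) : g (v' j) ≠ 0 := by
    by_cases hj : g (v j) ≠ 0
    · simp only [v', if_pos hj]
      exact hj
    · simp only [v', if_neg hj]
      exact hgf _ ((hnv j).resolve_right fun h0 => hj (hgf _ h0))
  have hσ (j : Fin d) : σ j * σ j = 1 := by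
    simp only [σ]; split_ifs <;> norm_num
  have htw (β : Fin d → ℝ) : (r : ℂ) • (T (α0 + σ * β) - (c : ℂ) • 1) =
      twisted ((M.map re).map ofReal) u' v' (fun j => r * a j) β := by
    have hsub (i k : Fin N) (x y : ℂ) :
        Matrix.single i k (x - y) = Matrix.single i k x - Matrix.single i k y := by
      rw [eq_sub_iff_add_eq, ← Matrix.single_add, sub_add_cancel]
    have hdiff : T (α0 + σ * β) - T α0 = ∑ j,
        (Matrix.single (u j) (v j) ((a j : ℂ) * (exp (I * (σ j * β j : ℝ)) - 1)) +
          Matrix.single (v j) (u j) ((a j : ℂ) * (exp (-(I * (σ j * β j : ℝ))) - 1))) := by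
      have h1 (j : Fin d) : h j * exp (I * ((α0 + σ * β) j : ℝ)) =
          a j * exp (I * (σ j * β j : ℝ)) := by
        rw [← ha, mul_assoc, ← exp_add, ← mul_add, ← ofReal_add]; rfl
      have h2 (j : Fin d) : (starRingEnd ℂ) (h j) * exp (-(I * ((α0 + σ * β) j : ℝ))) =
          a j * exp (-(I * (σ j * β j : ℝ))) := by
        rw [← ha', mul_assoc, ← exp_add, ← neg_add, ← mul_add, ← ofReal_add]; rfl
      rw [hT, hT, add_sub_add_left_eq_sub, ← Finset.sum_sub_distrib]
      refine Finset.sum_congr rfl fun j _ => ?_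
      rw [add_sub_add_comm, ← hsub, ← hsub, h1, h2, ha, ha', mul_sub_one, mul_sub_one]
    have hsplit : (r : ℂ) • (T (α0 + σ * β) - (c : ℂ) • (1 : Matrix (Fin N) (Fin N) ℂ)) =
        M + (r : ℂ) • (T (α0 + σ * β) - T α0) := by
      rw [hM, ← smul_add]; congr 1; abel
    rw [hMreal, twisted, hsplit, hdiff, Finset.smul_sum]
    congr 1
    refine Finset.sum_congr rfl fun j _ => ?_
    rw [smul_add, Matrix.smul_single, Matrix.smul_single, smul_eq_mul, smul_eq_mul, ← mul_assoc,
      ← mul_assoc, ← ofReal_mul]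
    by_cases hj : g (v j) ≠ 0
    · simp only [u', v', σ, if_pos hj, one_mul]
    · simp only [u', v', σ, if_neg hj, neg_one_mul, ofReal_neg, mul_neg, neg_neg]
      rw [add_comm]
  have hY : ∀ j, ∃ y : Fin N → ℝ, M.map re *ᵥ y = fun i => r * a j *
      (g (v' j) * (if i = u' j then 1 else 0) - g (u' j) * (if i = v' j then 1 else 0)) := by
    intro j
    apply hsolve
    simp only [dotProduct, mul_sub, Finset.sum_sub_distrib, mul_ite, mul_one, mul_zero,
      Finset.sum_ite_eq', Finset.mem_univ, if_true]
    ring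
  choose Y hY using hY
  have hα : α = α0 + σ * (σ * (α - α0)) := by
    ext j
    simp only [Pi.add_apply, Pi.mul_apply, Pi.sub_apply, ← mul_assoc, hσ]
    ring
  rw [hα, htw]
  rw [← hMreal] at hk hk' hMherm
  refine not_hasNegSubspace_twisted hMherm u' v' _ g hg' hg (of fun i j => Y j i) ?_ hk hk' ?_ _
  · ext i j
    have h1 := congrFun (hY j) i
    have h2 : ((M.map re).map ofReal * (of fun i j => Y j i).map ofReal : Matrix _ _ ℂ) i j =
        (((M.map re *ᵥ Y j) i : ℝ) : ℂ) := by
      simp [Matrix.mul_apply, mulVec, dotProduct]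
    rw [h2, h1, of_apply]
    split_ifs <;> push_cast <;> rfl
  · have hcont : Continuous fun β : Fin d → ℝ => α0 + σ * β := by fun_prop
    have := (hcont.tendsto' 0 α0 (by simp)).eventually hloc
    simpa only [htw] using this

/-- Theorem 1.5(1) of the paper: in the time-reversal symmetric case, a local extremum
of the band at a corner point `α° ∈ {0, π}^d` (simple eigenvalue, eigenvector
non-vanishing on crossing edges) is a global extremum. -/
theorem corner_local_extremum_is_global
    (d N : ℕ) (hd : 0 < d) (hN : 0 < N)
    (u v : Fin d → Fin N) (h : Fin d → ℂ) (hh : ∀ j, h j ≠ 0)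
    (T0 : Matrix (Fin N) (Fin N) ℂ) (hT0 : T0.IsHermitian)
    (T : (Fin d → ℝ) → Matrix (Fin N) (Fin N) ℂ)
    (hT : ∀ α : Fin d → ℝ, T α = T0 + ∑ j : Fin d,
      (Matrix.single (u j) (v j) (h j * Complex.exp (Complex.I * (α j : ℂ))) +
       Matrix.single (v j) (u j)
         ((starRingEnd ℂ) (h j) * Complex.exp (-(Complex.I * (α j : ℂ))))))
    (n : Fin N)
    (hT0real : ∀ i j, (T0 i j).im = 0) (hhreal : ∀ j, (h j).im = 0)
    (α0 : Fin d → ℝ) (f : Fin N → ℂ)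
    (hsimple : Nat.card {i : Fin N // sortedEigs (T α0) i = sortedEigs (T α0) n} = 1)
    (hunit : star f ⬝ᵥ f = (1 : ℂ))
    (heig : (T α0).mulVec f = ((sortedEigs (T α0) n : ℝ) : ℂ) • f)
    (hnv : ∀ j, f (u j) ≠ 0 ∨ f (v j) ≠ 0)
    (lam : (Fin d → ℝ) → ℝ) (hlam : ∀ α, lam α = sortedEigs (T α) n)
    (hcorner : ∀ j : Fin d, α0 j = 0 ∨ α0 j = Real.pi) :
    (IsLocalMin lam α0 → ∀ α : Fin d → ℝ, lam α0 ≤ lam α) ∧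
    (IsLocalMax lam α0 → ∀ α : Fin d → ℝ, lam α ≤ lam α0) := by
  have hherm (α : Fin d → ℝ) : (T α).IsHermitian := by
    rw [hT]
    refine hT0.add ?_
    rw [IsHermitian, conjTranspose_sum]
    refine Finset.sum_congr rfl fun j _ => ?_
    have hconj : (starRingEnd ℂ) (exp (I * (α j : ℂ))) = exp (-(I * (α j : ℂ))) := by
      rw [← exp_conj]; simp
    rw [conjTranspose_add, conjTranspose_single, conjTranspose_single, add_comm]
    simp only [RCLike.star_def, map_mul, ← hconj, conj_conj]
  have huniq : ∀ i, sortedEigs (T α0) i = sortedEigs (T α0) n → i = n := by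
    intro i hi
    have := (Nat.card_eq_one_iff_unique.1 hsimple).1
    exact congrArg Subtype.val (Subsingleton.elim
      (⟨i, hi⟩ : {i : Fin N // sortedEigs (T α0) i = sortedEigs (T α0) n}) ⟨n, rfl⟩)
  have hf : f ≠ 0 := by
    rintro rfl
    simp at hunit
  obtain ⟨hmono, U, hU, hU', hspec⟩ := exists_sorted_spectral (hherm α0)
  have hindex (r : ℝ) (k : ℕ) : HasNegSubspace
      ((r : ℂ) • (T α0 - (sortedEigs (T α0) n : ℂ) • 1)) k ↔ k ≤ (Finset.univ.filter fun i =>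
        r * (sortedEigs (T α0) i - sortedEigs (T α0) n) < 0).card := by
    rw [← hasNegSubspace_spectral_iff hU, ← smul_sub_spectral hU', ← hspec]
  refine ⟨fun hmin α => ?_, fun hmax α => ?_⟩
  · rw [hlam, hlam, ← not_lt, sortedEigs_lt_iff (hherm α)]
    refine not_hasNegSubspace_of_corner u v h T0 T hT hT0real hhreal α0 (hherm α0) hcorner n huniq
      f hf heig hnv 1 one_ne_zero ?_ ?_ ?_ α
    · rw [hindex, ← Fin.card_Iio]
      refine Finset.card_le_card fun i hi => ?_
      rw [Finset.mem_Iio] at hi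
      have := (hmono hi.le).lt_of_ne fun h0 => hi.ne (huniq i h0)
      simpa using this
    · rw [← sortedEigs_lt_iff (hherm α0)]
      exact lt_irrefl _
    · filter_upwards [hmin] with β hβ
      rw [← sortedEigs_lt_iff (hherm β), ← hlam, ← hlam]
      exact not_lt.2 hβ
  · have hk : N - n = N - 1 - n + 1 := by omega
    rw [hlam, hlam, ← not_lt, lt_sortedEigs_iff (hherm α), hk]
    refine not_hasNegSubspace_of_corner u v h T0 T hT hT0real hhreal α0 (hherm α0) hcorner n huniq
      f hf heig hnv (-1) (by norm_num) ?_ ?_ ?_ α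
    · rw [hindex, ← Fin.card_Ioi]
      refine Finset.card_le_card fun i hi => ?_
      rw [Finset.mem_Ioi] at hi
      have := (hmono hi.le).lt_of_ne fun h0 => hi.ne' (huniq i h0.symm)
      simpa using this
    · rw [← hk, ← lt_sortedEigs_iff (hherm α0)]
      exact lt_irrefl _
    · filter_upwards [hmax] with β hβ
      rw [← hk, ← lt_sortedEigs_iff (hherm β), ← hlam, ← hlam]
      exact not_lt.2 hβ
end
end
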